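/- For every ε > 0 there exist constants C > 0, c > 0 and N such that for every odd n ≥ N: with μ_n⊗μ_n-probability at least 1 − 1/n, a pair (A,B) of balanced dice satisfies the following: if Var_A − 12·CV_A² ≥ ε·n and Var_B − 12·CV_B² ≥ ε·n, then |P_n(A,B) − Q(ρ)| ≤ C·(log n)^c/√n, where ρ := (CV_{AB} − 12·CV_A·CV_B)/√((Var_A − 12·CV_A²)(Var_B − 12·CV_B²)) and Q(ρ) is the probability that both coordinates of a centered bivariate Gaussian vector with unit variances and correlation ρ are positive. -/

import Mathlib

open MeasureTheory ProbabilityTheory Set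
open scoped ENNReal NNReal

noncomputable def extendDie (n : ℕ) (s : ℝ) (a : Fin (n - 1) → ℝ) : Fin n → ℝ :=
  fun i => if h : (i : ℕ) < n - 1 then a ⟨i, h⟩ else s - ∑ j, a j

noncomputable def diceMeasure (n : ℕ) (lo hi s : ℝ) : Measure (Fin n → ℝ) :=
  Measure.map (extendDie n s)
    (ProbabilityTheory.cond volume
      {a : Fin (n - 1) → ℝ | (∀ i, a i ∈ Set.Icc lo hi) ∧ (s - ∑ i, a i) ∈ Set.Icc lo hi})

/-- `g_A(x) = |{i : a_i ≤ x}| - n·x` for a die with faces in `[0,1]`. -/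
noncomputable def gDie (n : ℕ) (A : Fin n → ℝ) (x : ℝ) : ℝ :=
  ((Finset.univ.filter fun i => A i ≤ x).card : ℝ) - n * x

/-- Expectation with respect to `V` uniform on `[0,1]`. -/
noncomputable def mean01 (f : ℝ → ℝ) : ℝ := ∫ x in Set.Icc (0 : ℝ) 1, f x

/-- `Var_A = Var(g_A(V))`. -/
noncomputable def varDie (n : ℕ) (A : Fin n → ℝ) : ℝ :=
  mean01 (fun x => gDie n A x ^ 2) - mean01 (gDie n A) ^ 2

/-- `CV_A = Cov(g_A(V), V)`. -/
noncomputable def cvDie (n : ℕ) (A : Fin n → ℝ) : ℝ :=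
  mean01 (fun x => gDie n A x * x) - mean01 (gDie n A) * mean01 (fun x => x)

/-- `CV_{AB} = Cov(g_A(V), g_B(V))`. -/
noncomputable def cvDie₂ (n : ℕ) (A B : Fin n → ℝ) : ℝ :=
  mean01 (fun x => gDie n A x * gDie n B x) - mean01 (gDie n A) * mean01 (gDie n B)

/-- The conditional probability `P_n(A,B)` that `n` i.i.d. uniform rolls with sum `n/2`
land positively for both `g`-sums, via the hyperplane parametrization. -/
noncomputable def Pcond (n : ℕ) (A B : Fin n → ℝ) : ℝ :=
  (volume {a : Fin (n - 1) → ℝ |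
      ((∀ i, a i ∈ Set.Icc (0 : ℝ) 1) ∧ ((n : ℝ) / 2 - ∑ i, a i) ∈ Set.Icc (0 : ℝ) 1) ∧
      0 < ∑ i, gDie n A (extendDie n ((n : ℝ) / 2) a i) ∧
      0 < ∑ i, gDie n B (extendDie n ((n : ℝ) / 2) a i)}).toReal /
  (volume {a : Fin (n - 1) → ℝ |
      (∀ i, a i ∈ Set.Icc (0 : ℝ) 1) ∧ ((n : ℝ) / 2 - ∑ i, a i) ∈ Set.Icc (0 : ℝ) 1}).toReal

/-- `Q(ρ)`: the probability that both coordinates of a centered bivariate Gaussian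
vector with unit variances and correlation `ρ` are positive. -/
noncomputable def Qgauss (ρ : ℝ) : ℝ :=
  (((gaussianReal 0 1).prod (gaussianReal 0 1))
    {p : ℝ × ℝ | 0 < p.1 ∧ 0 < ρ * p.1 + Real.sqrt (1 - ρ ^ 2) * p.2}).toReal

section Plancherel
open FourierTransform Complex Real Filter Topology
open scoped RealInnerProductSpace

/-- functions bounded by one and supported on the unit interval -/
def UnitKer (k : ℝ → ℂ) : Prop :=
  Measurable k ∧ (∀ x, ‖k x‖ ≤ 1) ∧ ∀ x, x ∉ Icc (0:ℝ) 1 → k x = 0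

lemma UnitKer.norm_le {k : ℝ → ℂ} (hk : UnitKer k) (x : ℝ) :
    ‖k x‖ ≤ (Icc (0:ℝ) 1).indicator (fun _ => (1:ℝ)) x := by
  by_cases h : x ∈ Icc (0:ℝ) 1
  · simp only [indicator_of_mem h]; exact hk.2.1 x
  · simp [indicator_of_notMem h, hk.2.2 x h]

lemma integrable_unitInd : Integrable ((Icc (0:ℝ) 1).indicator (fun _ => (1:ℝ))) := by
  rw [integrable_indicator_iff measurableSet_Icc]
  exact integrableOn_const (by simp)

lemma integral_unitInd : ∫ x, ((Icc (0:ℝ) 1).indicator (fun _ => (1:ℝ))) x = 1 := by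
  rw [integral_indicator measurableSet_Icc]; simp

lemma UnitKer.integrable {k : ℝ → ℂ} (hk : UnitKer k) : Integrable k :=
  integrable_unitInd.mono' hk.1.aestronglyMeasurable (ae_of_all _ hk.norm_le)

lemma UnitKer.integral_norm_le {k : ℝ → ℂ} (hk : UnitKer k) : ∫ x, ‖k x‖ ≤ 1 := by
  rw [← integral_unitInd]
  exact integral_mono hk.integrable.norm integrable_unitInd hk.norm_le

lemma UnitKer.norm_fourier_le {k : ℝ → ℂ} (hk : UnitKer k) (ξ : ℝ) : ‖𝓕 k ξ‖ ≤ 1 :=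
  (VectorFourier.norm_fourierIntegral_le_integral_norm _ _ _ _ _).trans hk.integral_norm_le

lemma UnitKer.continuous_fourier {k : ℝ → ℂ} (hk : UnitKer k) : Continuous (𝓕 k) :=
  VectorFourier.fourierIntegral_continuous Real.continuous_fourierChar
    (by exact continuous_inner) hk.integrable

lemma gauss_smooth_bound {k : ℝ → ℂ} (hk : UnitKer k) {c : ℝ} (hc : 0 < c) (v : ℝ) :
    ‖∫ w : ℝ, cexp (- c⁻¹ * ‖w‖ ^ 2 + 2 * π * I * ⟪v, w⟫) • (𝓕 k) w‖ ≤ 1 := by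
  have J : Integrable (fun w : ℝ ↦ cexp (- c⁻¹ * ‖w‖ ^ 2 + 2 * π * I * ⟪v, w⟫)) :=
      GaussianFourier.integrable_cexp_neg_mul_sq_norm_add (by simpa) _ _
  have h1 : ∫ w : ℝ, cexp (- c⁻¹ * ‖w‖ ^ 2 + 2 * π * I * ⟪v, w⟫) • (𝓕 k) w
      = ∫ w : ℝ, 𝓕 (fun w : ℝ ↦ cexp (- c⁻¹ * ‖w‖ ^ 2 + 2 * π * I * ⟪v, w⟫)) w • k w := by
    simpa using! (VectorFourier.integral_fourierIntegral_smul_eq_flip (L := innerₗ ℝ)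
      Real.continuous_fourierChar continuous_inner J hk.integrable).symm
  rw [h1]
  have h2 : ∀ w : ℝ, ‖𝓕 (fun w : ℝ ↦ cexp (- c⁻¹ * ‖w‖ ^ 2 + 2 * π * I * ⟪v, w⟫)) w‖
      = √(π * c) * rexp (-(π^2 * c) * (w - v)^2) := by
    intro w
    have := fourier_gaussian_innerProductSpace' (V := ℝ) (b := ((c⁻¹ : ℝ) : ℂ))
      (by simpa using hc) v w
    rw [this, norm_mul, ofReal_inv]
    congr 1
    · rw [show ((π : ℂ) / ((c : ℂ))⁻¹) = ((π * c : ℝ) : ℂ) by push_cast; field_simp,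
        norm_cpow_eq_rpow_re_of_pos (by positivity)]
      simp [Real.sqrt_eq_rpow]
    · rw [norm_exp]
      congr 1
      have : (-(π:ℂ) ^ 2 * (‖v - w‖ : ℂ) ^ 2 / ((c : ℂ))⁻¹) = ((-π ^ 2 * ‖v - w‖ ^ 2 * c : ℝ) : ℂ) := by
        push_cast; field_simp
      rw [this, ofReal_re, Real.norm_eq_abs, sq_abs]; ring
  have hg : Integrable (fun w : ℝ => √(π * c) * rexp (-(π^2 * c) * (w - v)^2)) :=
    ((integrable_exp_neg_mul_sq (b := π^2 * c) (by positivity)).comp_sub_right v).const_mul _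
  calc _ ≤ ∫ w : ℝ, √(π * c) * rexp (-(π^2 * c) * (w - v)^2) := by
        refine norm_integral_le_of_norm_le hg (ae_of_all _ fun w => ?_)
        rw [norm_smul, h2]
        exact mul_le_of_le_one_right (by positivity) (hk.2.1 w)
    _ = 1 := by
        rw [integral_const_mul, integral_sub_right_eq_self (fun w => rexp (-(π^2 * c) * w^2)) v,
          integral_gaussian, ← Real.sqrt_mul (by positivity)]
        rw [Real.sqrt_eq_one]; field_simp

lemma gauss_plancherel {k : ℝ → ℂ} (hk : UnitKer k) {c : ℝ} (hc : 0 < c) :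
    ∫ w : ℝ, rexp (- c⁻¹ * w ^ 2) * ‖𝓕 k w‖ ^ 2 ≤ 1 := by
  have hInteg : Integrable (fun w : ℝ => ((rexp (- c⁻¹ * w ^ 2) : ℝ) : ℂ) * 𝓕 k w) := by
    refine (integrable_exp_neg_mul_sq (b := c⁻¹) (by positivity)).mono'
      ?_ (ae_of_all _ fun w => ?_)
    · refine Continuous.aestronglyMeasurable ?_
      have := hk.continuous_fourier
      fun_prop
    · rw [norm_mul, norm_real, Real.norm_eq_abs, abs_exp]
      exact mul_le_of_le_one_right (by positivity) (hk.norm_fourier_le w)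
  have h1 := VectorFourier.integral_sesq_fourierIntegral_eq_neg_flip (L := innerₗ ℝ)
      (innerSL ℂ) Real.continuous_fourierChar continuous_inner hk.integrable hInteg
  have h2 : ∫ w : ℝ, ((rexp (- c⁻¹ * w ^ 2) * ‖𝓕 k w‖ ^ 2 : ℝ) : ℂ)
      = ∫ x : ℝ, (innerSL ℂ (k x)) (∫ w : ℝ, cexp (- c⁻¹ * ‖w‖ ^ 2 + 2 * π * I * ⟪x, w⟫) • (𝓕 k) w) := by
    refine Eq.trans ?_ (h1.trans ?_)
    swap
    · refine integral_congr_ae (ae_of_all _ fun x => ?_)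
      simp only
      congr 1
      refine integral_congr_ae (ae_of_all _ fun w => ?_)
      simp only [Circle.smul_def, Real.fourierChar_apply, smul_eq_mul, ← mul_assoc]
      congr 1
      rw [ofReal_exp, ← Complex.exp_add]
      congr 1
      have hw : ((|w| : ℝ) : ℂ) ^ 2 = (w : ℂ) ^ 2 := by
        rw [← ofReal_pow, sq_abs, ofReal_pow]
      simp [hw]
      ring
    · refine integral_congr_ae (ae_of_all _ fun w => ?_)
      change _ = (innerSL ℂ (𝓕 k w)) (((rexp (- c⁻¹ * w ^ 2) : ℝ) : ℂ) * 𝓕 k w)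
      rw [innerSL_apply_apply, RCLike.inner_apply, mul_assoc, Complex.mul_conj, Complex.normSq_eq_norm_sq]
      push_cast; ring
  have h3 : ‖∫ w : ℝ, ((rexp (- c⁻¹ * w ^ 2) * ‖𝓕 k w‖ ^ 2 : ℝ) : ℂ)‖ ≤ 1 := by
    rw [h2]
    refine (norm_integral_le_of_norm_le hk.integrable.norm (ae_of_all _ fun x => ?_)).trans
      hk.integral_norm_le
    rw [innerSL_apply_apply]
    refine (norm_inner_le_norm _ _).trans ?_
    exact mul_le_of_le_one_right (norm_nonneg _) (gauss_smooth_bound hk hc x)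
  rw [integral_complex_ofReal, norm_real] at h3
  exact (le_abs_self _).trans h3

lemma plancherel_le {k : ℝ → ℂ} (hk : UnitKer k) :
    Integrable (fun w => ‖𝓕 k w‖ ^ 2) ∧ ∫ w : ℝ, ‖𝓕 k w‖ ^ 2 ≤ 1 := by
  have hcont : Continuous (fun w => ‖𝓕 k w‖ ^ 2) := (hk.continuous_fourier.norm.pow 2)
  have key : ∫⁻ w : ℝ, ENNReal.ofReal (‖𝓕 k w‖ ^ 2) ≤ 1 := by
    have hlim : ∀ w : ℝ, Tendsto (fun m : ℕ => ENNReal.ofReal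
        (rexp (- ((m:ℝ)+1)⁻¹ * w ^ 2) * ‖𝓕 k w‖ ^ 2)) atTop (𝓝 (ENNReal.ofReal (‖𝓕 k w‖ ^ 2))) := by
      intro w
      refine ENNReal.tendsto_ofReal ?_
      have h0 : Tendsto (fun m : ℕ => ((m:ℝ)+1)⁻¹) atTop (𝓝 0) := by
        simpa using tendsto_one_div_add_atTop_nhds_zero_nat (𝕜 := ℝ)
      have h1 : Tendsto (fun m : ℕ => rexp (- ((m:ℝ)+1)⁻¹ * w ^ 2)) atTop (𝓝 (rexp (-0 * w^2))) :=
        (Real.continuous_exp.tendsto _).comp ((h0.neg).mul_const _)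
      simpa using h1.mul_const (‖𝓕 k w‖ ^ 2)
    calc ∫⁻ w : ℝ, ENNReal.ofReal (‖𝓕 k w‖ ^ 2)
        = ∫⁻ w : ℝ, liminf (fun m : ℕ => ENNReal.ofReal
          (rexp (- ((m:ℝ)+1)⁻¹ * w ^ 2) * ‖𝓕 k w‖ ^ 2)) atTop := by
          refine lintegral_congr fun w => (hlim w).liminf_eq.symm
      _ ≤ liminf (fun m : ℕ => ∫⁻ w : ℝ, ENNReal.ofReal
          (rexp (- ((m:ℝ)+1)⁻¹ * w ^ 2) * ‖𝓕 k w‖ ^ 2)) atTop := by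
          refine lintegral_liminf_le fun m => ?_
          exact ENNReal.measurable_ofReal.comp
            (Continuous.measurable (by have := hk.continuous_fourier; fun_prop))
      _ ≤ 1 := by
          refine (liminf_le_liminf (v := fun _ => (1:ℝ≥0∞)) (Eventually.of_forall fun m => ?_)).trans
            (by simp)
          have hm : (0:ℝ) < (m:ℝ) + 1 := by positivity
          have hi : Integrable (fun w : ℝ => rexp (- ((m:ℝ)+1)⁻¹ * w ^ 2) * ‖𝓕 k w‖ ^ 2) := by
            refine (integrable_exp_neg_mul_sq (b := ((m:ℝ)+1)⁻¹) (by positivity)).mono'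
              (Continuous.aestronglyMeasurable (by have := hk.continuous_fourier; fun_prop))
              (ae_of_all _ fun w => ?_)
            rw [Real.norm_eq_abs, abs_of_nonneg (by positivity)]
            exact mul_le_of_le_one_right (by positivity)
              (pow_le_one₀ (norm_nonneg _) (hk.norm_fourier_le w))
          rw [← ofReal_integral_eq_lintegral_ofReal hi (ae_of_all _ fun w => by positivity)]
          simpa using gauss_plancherel hk hm
  have hInteg : Integrable (fun w => ‖𝓕 k w‖ ^ 2) := by
    refine ⟨hcont.aestronglyMeasurable, ?_⟩
    rw [hasFiniteIntegral_iff_ofReal (ae_of_all _ fun w => by positivity)]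
    exact key.trans_lt ENNReal.one_lt_top
  refine ⟨hInteg, ?_⟩
  rw [← ofReal_integral_eq_lintegral_ofReal hInteg (ae_of_all _ fun w => by positivity)] at key
  simpa using key

end Plancherel

section Inversion
open FourierTransform Complex Real Filter Topology
open scoped RealInnerProductSpace

lemma sum_null {m : ℕ} (hm : 1 ≤ m) (S : Set ℝ) (hS : S.Countable) (t : ℝ) :
    ∀ᵐ a : Fin m → ℝ, t - ∑ i, a i ∉ S := by
  have hT : (volume : Measure ℝ) ((fun x => t - x) ⁻¹' S) = 0 := by
    have : ((fun x => t - x) ⁻¹' S).Countable :=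
      hS.preimage (sub_right_injective)
    exact this.measure_zero _
  let ℓ : (Fin m → ℝ) →ₗ[ℝ] ℝ := ∑ i, LinearMap.proj i
  have hℓ : ∀ a, ℓ a = ∑ i, a i := by intro a; simp [ℓ]
  have hsurj : Function.Surjective ℓ := by
    intro y
    refine ⟨Pi.single ⟨0, hm⟩ y, ?_⟩
    rw [hℓ]; simp
  obtain ⟨c, -, hc⟩ := ℓ.exists_map_addHaar_eq_smul_addHaar volume volume hsurj
  have h2 : (Measure.map ℓ volume) ((fun x => t - x) ⁻¹' S) = 0 := by
    rw [hc]; simp [hT]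
  have hmeas : Measurable ℓ := ℓ.continuous_of_finiteDimensional.measurable
  rw [Measure.map_apply hmeas] at h2
  · rw [ae_iff]
    convert h2 using 2
    ext a
    simp [hℓ]
  · exact (hS.preimage sub_right_injective).measurableSet

lemma shear_mp (m : ℕ) : MeasurePreserving
    (fun p : (Fin m → ℝ) × ℝ => (p.1, p.2 - ∑ i, p.1 i)) (volume.prod volume) (volume.prod volume) := by
  refine MeasurePreserving.skew_product (g := fun (a : Fin m → ℝ) (t : ℝ) => t - ∑ i, a i)
    (MeasurePreserving.id _) ?_ (ae_of_all _ fun a => ?_)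
  · fun_prop
  · exact (measurePreserving_sub_right volume (∑ i, a i)).map_eq

lemma slice_integrable {k : ℝ → ℂ} (hk : UnitKer k) (m : ℕ) :
    Integrable (fun p : (Fin m → ℝ) × ℝ => (∏ i, k (p.1 i)) * k (p.2 - ∑ i, p.1 i))
      (volume.prod volume) := by
  have h0 : Integrable (fun a : Fin m → ℝ => ∏ i, k (a i)) :=
    Integrable.fintype_prod (f := fun _ => k) (fun _ => hk.integrable)
  have h1 : Integrable (fun p : (Fin m → ℝ) × ℝ => (∏ i, k (p.1 i)) * k p.2)
      (volume.prod volume) := h0.mul_prod hk.integrable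
  exact (shear_mp m).integrable_comp_of_integrable h1

lemma slice_inversion {m : ℕ} (hm : 1 ≤ m) {k : ℝ → ℂ} (hk : UnitKer k) (S : Set ℝ)
    (hS : S.Countable) (hc : ∀ x, x ∉ S → ContinuousAt k x) (t : ℝ) :
    ∫ a : Fin m → ℝ, (∏ i, k (a i)) * k (t - ∑ i, a i)
      = ∫ ξ : ℝ, cexp (((2 * π * ξ * t : ℝ) : ℂ) * I) * (𝓕 k ξ) ^ (m + 1) := by
  set H : ℝ → ℂ := fun t => ∫ a : Fin m → ℝ, (∏ i, k (a i)) * k (t - ∑ i, a i) with hH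
  have h0 : Integrable (fun a : Fin m → ℝ => ∏ i, k (a i)) :=
    Integrable.fintype_prod (f := fun _ => k) (fun _ => hk.integrable)
  have hHint : Integrable H := (slice_integrable hk m).integral_prod_right
  have hF : 𝓕 H = fun ξ => (𝓕 k ξ) ^ (m + 1) := by
    funext ξ
    rw [fourier_real_eq_integral_exp_smul]
    simp only [hH, smul_eq_mul, ← integral_const_mul]
    rw [integral_integral_swap]
    · have h1 : ∀ a : Fin m → ℝ, ∫ x : ℝ, cexp (((-2 * π * x * ξ : ℝ) : ℂ) * I) *
          ((∏ i, k (a i)) * k (x - ∑ i, a i))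
          = (∏ i, (cexp (((-2 * π * a i * ξ : ℝ) : ℂ) * I) * k (a i))) * 𝓕 k ξ := by
        intro a
        rw [fourier_real_eq_integral_exp_smul, ← integral_const_mul,
          ← integral_sub_right_eq_self (fun x => (∏ i, (cexp (((-2 * π * a i * ξ : ℝ) : ℂ) * I) *
            k (a i))) * (cexp (((-2 * π * x * ξ : ℝ) : ℂ) * I) • k x)) (∑ i, a i)]
        refine integral_congr_ae (ae_of_all _ fun x => ?_)
        simp only [smul_eq_mul]
        rw [Finset.prod_mul_distrib, ← Complex.exp_sum]
        rw [show ((-2 * π * x * ξ : ℝ) : ℂ) * I = (∑ i, ((-2 * π * a i * ξ : ℝ) : ℂ) * I) +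
          ((-2 * π * (x - ∑ i, a i) * ξ : ℝ) : ℂ) * I from ?_, Complex.exp_add]
        · ring
        · rw [← Finset.sum_mul, ← add_mul]
          congr 1
          rw [← ofReal_sum, ← ofReal_add]
          congr 1
          rw [← Finset.sum_mul, ← Finset.mul_sum]
          ring
      simp only [h1]
      rw [integral_mul_const, integral_fintype_prod_volume_eq_prod (fun _ : Fin m => fun x : ℝ =>
        cexp (((-2 * π * x * ξ : ℝ) : ℂ) * I) * k x)]
      have h2 := fourier_real_eq_integral_exp_smul k ξ
      simp only [smul_eq_mul] at h2
      rw [← h2]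
      simp [pow_succ]
    · have hsw := (slice_integrable hk m).swap
      refine (hsw.norm).mono' ?_ (ae_of_all _ fun p => ?_)
      · refine AEStronglyMeasurable.mul (Continuous.aestronglyMeasurable (by fun_prop)) ?_
        exact hsw.aestronglyMeasurable
      · simp only [Function.uncurry]
        rw [norm_mul, Complex.norm_exp_ofReal_mul_I, one_mul]
        exact le_refl _
  have hFint : Integrable (𝓕 H) := by
    rw [hF]
    refine (plancherel_le hk).1.mono' ((hk.continuous_fourier.pow _).aestronglyMeasurable)
      (ae_of_all _ fun ξ => ?_)
    rw [norm_pow]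
    exact pow_le_pow_of_le_one (norm_nonneg _) (hk.norm_fourier_le ξ) (by omega)
  have hcont : ContinuousAt H t := by
    refine continuousAt_of_dominated (bound := fun a => ‖∏ i, k (a i)‖) ?_ ?_ h0.norm ?_
    · refine Eventually.of_forall fun s => ?_
      have : Measurable k := hk.1
      exact Measurable.aestronglyMeasurable (by fun_prop)
    · refine Eventually.of_forall fun s => ae_of_all _ fun a => ?_
      rw [norm_mul]
      exact mul_le_of_le_one_right (norm_nonneg _) (hk.2.1 _)
    · filter_upwards [sum_null hm S hS t] with a ha
      refine continuousAt_const.mul ?_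
      exact ContinuousAt.comp (f := fun s : ℝ => s - ∑ i, a i) (g := k) (hc _ ha) (by fun_prop)
  have := hHint.fourierInv_fourier_eq hFint hcont
  change H t = _
  rw [← this, fourierInv_eq', hF]
  refine integral_congr_ae (ae_of_all _ fun ξ => ?_)
  simp only [smul_eq_mul]
  congr 4
  simp
  ring

end Inversion

section CharEst
open FourierTransform Complex Real Filter Topology
open scoped RealInnerProductSpace

lemma taylor_exp_nonneg {x : ℝ} (hx : 0 ≤ x) :
    ‖cexp (x * I) - (1 + x * I - (x:ℂ) ^ 2 / 2)‖ ≤ x ^ 3 / 6 := by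
  have hexp : ∀ y : ℝ, HasDerivAt (fun y : ℝ => cexp (y * I)) (cexp (y * I) * I) y := by
    intro y
    have := ((hasDerivAt_id (y:ℂ)).mul_const I).cexp.comp_ofReal
    simpa using this
  have hid : ∀ y : ℝ, HasDerivAt (fun y : ℝ => (y : ℂ)) 1 y := fun y => by
    simpa using (hasDerivAt_id (y:ℂ)).comp_ofReal
  have h1 : ∀ y : ℝ, 0 ≤ y → ‖cexp (y * I) - 1‖ ≤ y := by
    intro y hy
    have := Real.norm_exp_I_mul_ofReal_sub_one_le (x := y)
    rw [mul_comm] at this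
    simpa [abs_of_nonneg hy] using this
  have h2 : ∀ y : ℝ, 0 ≤ y → ‖cexp (y * I) - (1 + y * I)‖ ≤ y ^ 2 / 2 := by
    intro y hy
    refine image_norm_le_of_norm_deriv_right_le_deriv_boundary (a := 0) (b := y)
      (f := fun y : ℝ => cexp (y * I) - (1 + y * I))
      (f' := fun y => cexp (y * I) * I - (0 + 1 * I)) (B := fun y => y ^ 2 / 2) (B' := fun y => y)
      (by fun_prop) ?_ (by simp) ?_ ?_ ⟨hy, le_rfl⟩
    · intro z _
      exact ((hexp z).sub ((hasDerivAt_const z (1:ℂ)).add ((hid z).mul_const I))).hasDerivWithinAt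
    · intro z
      have := ((hasDerivAt_id z).pow 2).div_const 2
      simpa using this
    · intro z hz
      have : cexp (z * I) * I - (0 + 1 * I) = (cexp (z * I) - 1) * I := by ring
      rw [this, norm_mul, norm_I, mul_one]
      exact h1 z hz.1
  refine image_norm_le_of_norm_deriv_right_le_deriv_boundary (a := 0) (b := x)
      (f := fun y : ℝ => cexp (y * I) - (1 + y * I - (y:ℂ) ^ 2 / 2))
      (f' := fun y => cexp (y * I) * I - (0 + 1 * I - ((2 * y : ℂ)) / 2))
      (B := fun y => y ^ 3 / 6) (B' := fun y => y ^ 2 / 2)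
      (by fun_prop) ?_ (by simp) ?_ ?_ ⟨hx, le_rfl⟩
  · intro z _
    have hs : HasDerivAt (fun y : ℝ => (y : ℂ) ^ 2 / 2) ((2 * z : ℂ) / 2) z := by
      simpa using ((hid z).pow 2).div_const 2
    exact ((hexp z).sub (((hasDerivAt_const z (1:ℂ)).add ((hid z).mul_const I)).sub hs)).hasDerivWithinAt
  · intro z
    have := (hasDerivAt_pow 3 z).div_const 6
    have e : ((3:ℕ):ℝ) * z ^ (3 - 1) / 6 = z ^ 2 / 2 := by norm_num; ring
    rwa [e] at this
  · intro z hz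
    have : cexp (z * I) * I - (0 + 1 * I - (2 * z : ℂ) / 2) = (cexp (z * I) - (1 + z * I)) * I := by
      ring_nf; simp
    rw [this, norm_mul, norm_I, mul_one]
    exact h2 z hz.1

lemma taylor_exp (x : ℝ) :
    ‖cexp (x * I) - (1 + x * I - (x:ℂ) ^ 2 / 2)‖ ≤ |x| ^ 3 / 6 := by
  rcases le_total 0 x with h | h
  · rw [abs_of_nonneg h]; exact taylor_exp_nonneg h
  · rw [abs_of_nonpos h]
    have := taylor_exp_nonneg (x := -x) (by linarith)
    rw [← Complex.norm_conj] at this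
    convert this using 2
    simp [← Complex.exp_conj, map_ofNat]

lemma norm_pow_sub_pow_le' {z w : ℂ} {M : ℝ} (hz : ‖z‖ ≤ M) (hw : ‖w‖ ≤ M) (n : ℕ) :
    ‖z ^ (n+1) - w ^ (n+1)‖ ≤ (n+1) * ‖z - w‖ * M ^ n := by
  have hM : 0 ≤ M := (norm_nonneg _).trans hz
  induction n with
  | zero => simp
  | succ n ih =>
    have : z ^ (n+1+1) - w ^ (n+1+1) = z * (z ^ (n+1) - w ^ (n+1)) + (z - w) * w ^ (n+1) := by ring
    rw [this]
    calc _ ≤ ‖z‖ * ‖z ^ (n+1) - w ^ (n+1)‖ + ‖z - w‖ * ‖w‖ ^ (n+1) := by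
          refine (norm_add_le _ _).trans ?_
          rw [norm_mul, norm_mul, norm_pow]
      _ ≤ M * ((n+1) * ‖z - w‖ * M ^ n) + ‖z - w‖ * M ^ (n+1) := by gcongr
      _ = _ := by push_cast; ring

/-- the uniform law on the unit interval -/
noncomputable abbrev unifI : Measure ℝ := volume.restrict (Icc (0:ℝ) 1)

instance : IsProbabilityMeasure unifI := ⟨by simp⟩

lemma integrable_unifI_of_bdd {f : ℝ → ℝ} (hf : Measurable f) {C : ℝ}
    (hC : ∀ x ∈ Icc (0:ℝ) 1, |f x| ≤ C) : Integrable f unifI := by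
  refine Integrable.mono' (integrable_const C) hf.aestronglyMeasurable ?_
  filter_upwards [ae_restrict_mem measurableSet_Icc] with x hx using hC x hx

lemma char_taylor {Z : ℝ → ℝ} (hZ : Measurable Z) {R V : ℝ}
    (hR : ∀ x ∈ Icc (0:ℝ) 1, |Z x| ≤ R) (h1 : ∫ x, Z x ∂unifI = 0)
    (h2 : ∫ x, Z x ^ 2 ∂unifI = V) :
    ‖∫ x, cexp (Z x * I) ∂unifI - ((1 - V / 2 : ℝ) : ℂ)‖ ≤ V * R / 6 := by
  have hR0 : 0 ≤ R := (abs_nonneg _).trans (hR 0 (by simp))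
  have i1 : Integrable Z unifI := integrable_unifI_of_bdd hZ hR
  have i2 : Integrable (fun x => Z x ^ 2) unifI :=
    integrable_unifI_of_bdd (C := R ^ 2) (hZ.pow_const 2) fun x hx => by
      rw [abs_pow]; exact pow_le_pow_left₀ (abs_nonneg _) (hR x hx) 2
  have i3 : Integrable (fun x => cexp (Z x * I)) unifI := by
    refine Integrable.mono' (integrable_const (1:ℝ))
      (Measurable.aestronglyMeasurable (by fun_prop)) (ae_of_all _ fun x => ?_)
    rw [Complex.norm_exp_ofReal_mul_I]
  have e : ∫ x, cexp (Z x * I) ∂unifI - ((1 - V / 2 : ℝ) : ℂ)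
      = ∫ x, (cexp (Z x * I) - (1 + Z x * I - (Z x:ℂ) ^ 2 / 2)) ∂unifI := by
    have j1 : Integrable (fun x => (Z x : ℂ) * I) unifI := i1.ofReal.mul_const I
    have j2 : Integrable (fun x => (Z x : ℂ) ^ 2 / 2) unifI := by
      have := (i2.ofReal (𝕜 := ℂ)).div_const 2
      simpa using this
    have j0 : Integrable (fun x : ℝ => (1:ℂ)) unifI := integrable_const _
    have j01 : Integrable (fun x => 1 + (Z x : ℂ) * I) unifI := j0.add j1
    have j012 : Integrable (fun x => 1 + (Z x : ℂ) * I - (Z x : ℂ) ^ 2 / 2) unifI := j01.sub j2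
    rw [integral_sub i3 j012, integral_sub j01 j2, integral_add j0 j1, integral_mul_const,
      integral_div]
    have k1 : ∫ x, (Z x : ℂ) ∂unifI = 0 := by
      rw [integral_complex_ofReal, h1]; simp
    have k2 : ∫ x, (Z x : ℂ) ^ 2 ∂unifI = (V : ℂ) := by
      rw [← h2, ← integral_complex_ofReal]; simp
    rw [k1, k2]
    simp
  rw [e]
  calc _ ≤ ∫ x, Z x ^ 2 * (R / 6) ∂unifI := by
        refine norm_integral_le_of_norm_le (i2.mul_const _) ?_
        filter_upwards [ae_restrict_mem measurableSet_Icc] with x hx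
        refine (taylor_exp (Z x)).trans ?_
        have := hR x hx
        have h3 : |Z x| ^ 3 = Z x ^ 2 * |Z x| := by rw [← sq_abs]; ring
        rw [h3]
        nlinarith [sq_nonneg (Z x)]
    _ = _ := by rw [integral_mul_const, h2]; ring

end CharEst

section CharEst2
open FourierTransform Complex Real Filter Topology
open scoped RealInnerProductSpace

/-- A centred profile on the unit interval, orthogonal to the identity. -/
structure Prof (f : ℝ → ℝ) (r v : ℝ) : Prop where
  meas : Measurable f
  bd : ∀ x ∈ Icc (0:ℝ) 1, |f x| ≤ r
  m0 : ∫ x, f x ∂unifI = 0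
  m1 : ∫ x, f x * x ∂unifI = 0
  m2 : ∫ x, f x ^ 2 ∂unifI = v

/-- tilted characteristic function -/
noncomputable def PhiF (f : ℝ → ℝ) (θ : ℝ) : ℂ :=
  ∫ x, cexp (((f x - θ * (x - 1/2) : ℝ) : ℂ) * I) ∂unifI

lemma int_unif_id : ∫ x, x ∂unifI = 1/2 := by
  rw [integral_Icc_eq_integral_Ioc, ← intervalIntegral.integral_of_le zero_le_one]
  simp

lemma int_unif_sq : ∫ x, (x - 1/2)^2 ∂unifI = 1/12 := by
  rw [integral_Icc_eq_integral_Ioc, ← intervalIntegral.integral_of_le zero_le_one]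
  rw [intervalIntegral.integral_comp_sub_right (fun x => x^2)]
  simp; norm_num

variable {f : ℝ → ℝ} {r v : ℝ}

lemma Prof.r_nonneg (h : Prof f r v) : 0 ≤ r := (abs_nonneg _).trans (h.bd 0 (by simp))

lemma Prof.int (h : Prof f r v) : Integrable f unifI := integrable_unifI_of_bdd h.meas h.bd

lemma Prof.int_sq (h : Prof f r v) : Integrable (fun x => f x ^ 2) unifI :=
  integrable_unifI_of_bdd (C := r ^ 2) (h.meas.pow_const 2) fun x hx => by
      rw [abs_pow]; exact pow_le_pow_left₀ (abs_nonneg _) (h.bd x hx) 2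

lemma Prof.int_mul (h : Prof f r v) : Integrable (fun x => f x * x) unifI :=
  integrable_unifI_of_bdd (C := r) (h.meas.mul measurable_id) fun x hx => by
      rw [abs_mul]
      calc |f x| * |x| ≤ r * 1 := by
            gcongr
            · exact h.r_nonneg
            · exact h.bd x hx
            · rw [abs_of_nonneg hx.1]; exact hx.2
        _ = r := mul_one r

lemma Prof.v_nonneg (h : Prof f r v) : 0 ≤ v := by
  rw [← h.m2]; exact integral_nonneg fun x => sq_nonneg _

lemma Prof.v_le (h : Prof f r v) : v ≤ r ^ 2 := by
  rw [← h.m2]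
  calc ∫ x, f x ^ 2 ∂unifI ≤ ∫ x, r ^ 2 ∂unifI := by
        refine integral_mono_ae h.int_sq (integrable_const _) ?_
        filter_upwards [ae_restrict_mem measurableSet_Icc] with x hx
        exact sq_le_sq' (by linarith [neg_abs_le (f x), h.bd x hx]) (by linarith [le_abs_self (f x), h.bd x hx])
    _ = r ^ 2 := by simp

lemma Prof.taylor (h : Prof f r v) (θ : ℝ) :
    ‖PhiF f θ - ((1 - (v + θ^2/12) / 2 : ℝ) : ℂ)‖ ≤ (v + θ^2/12) * (r + |θ|/2) / 6 := by
  have iid : Integrable (fun x : ℝ => x - 1/2) unifI :=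
    integrable_unifI_of_bdd (C := 1) (by fun_prop) fun x hx => by
      rw [abs_le]; constructor <;> linarith [hx.1, hx.2]
  have iid0 : Integrable (fun x : ℝ => x) unifI :=
    integrable_unifI_of_bdd (C := 1) (by fun_prop) fun x hx => by
      rw [abs_le]; constructor <;> linarith [hx.1, hx.2]
  have iid2 : Integrable (fun x : ℝ => (x - 1/2)^2) unifI :=
    integrable_unifI_of_bdd (C := 1) (by fun_prop) fun x hx => by
      rw [abs_le]; constructor <;> nlinarith [hx.1, hx.2]
  refine char_taylor (Z := fun x => f x - θ * (x - 1/2)) ?_ ?_ ?_ ?_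
  · have := h.meas; fun_prop
  · intro x hx
    calc |f x - θ * (x - 1/2)| ≤ |f x| + |θ * (x - 1/2)| := abs_sub _ _
      _ ≤ r + |θ| * (1/2) := by
        rw [abs_mul]
        gcongr
        · exact h.bd x hx
        · rw [abs_le]; constructor <;> linarith [hx.1, hx.2]
      _ = _ := by ring
  · rw [integral_sub h.int (iid.const_mul θ), h.m0, integral_const_mul,
      integral_sub iid0 (integrable_const _), int_unif_id]
    simp
  · have e : ∀ x, (f x - θ * (x - 1/2))^2 = (f x ^ 2 + θ^2 * (x - 1/2)^2) + (-(2*θ) * (f x * x) + θ * f x) := by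
      intro x; ring
    simp_rw [e]
    have q1 : Integrable (fun x => f x ^ 2 + θ^2 * (x - 1/2)^2) unifI :=
      h.int_sq.add (iid2.const_mul _)
    have q2 : Integrable (fun x => -(2*θ) * (f x * x) + θ * f x) unifI :=
      (h.int_mul.const_mul _).add (h.int.const_mul _)
    rw [integral_add q1 q2,
      integral_add h.int_sq (iid2.const_mul _),
      integral_add (h.int_mul.const_mul _) (h.int.const_mul _)]
    rw [h.m2]
    simp only [integral_const_mul]
    rw [h.m0, h.m1, int_unif_sq]
    ring

lemma exp_neg_quad {x : ℝ} (hx : 0 ≤ x) : Real.exp (-x) ≤ 1 - x + x^2/2 := by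
  have h := Real.quadratic_le_exp_of_nonneg hx
  have hp : 0 < Real.exp (-x) := Real.exp_pos _
  have h1 : Real.exp (-x) * Real.exp x = 1 := by rw [← Real.exp_add]; simp
  have h2 : Real.exp (-x) * (1 + x + x^2/2) ≤ 1 := by
    calc _ ≤ Real.exp (-x) * Real.exp x := by gcongr
      _ = 1 := h1
  have h3 : 0 ≤ 1 - x + x^2/2 := by nlinarith [sq_nonneg (x-1)]
  have h5 : (1 + x + x^2/2) * (1 - x + x^2/2) = 1 + x^4/4 := by ring
  have h6 : 0 ≤ x^4 := by positivity
  have : 0 < 1 + x + x^2/2 := by positivity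
  by_contra hc
  push Not at hc
  nlinarith

lemma mul_exp_neg_le_one {x : ℝ} : x * Real.exp (-x) ≤ 1 := by
  have := Real.add_one_le_exp x
  have hp : 0 < Real.exp (-x) := Real.exp_pos _
  have h1 : Real.exp (-x) * Real.exp x = 1 := by rw [← Real.exp_add]; simp
  nlinarith

lemma Prof.central (h : Prof f r v) (hr : r ≤ 1/4) {θ : ℝ} (hθ : |θ| ≤ 3) (k : ℕ) :
    ‖PhiF f θ ^ (k+1) - ((Real.exp (-((k+1:ℝ) * (v + θ^2/12))/2) : ℝ) : ℂ)‖
      ≤ 36 * (r + |θ|/2) * Real.exp (-((k+1:ℝ) * (v + θ^2/12))/8) := by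
  have hT := h.taylor θ
  set V := v + θ^2/12 with hV
  set R := r + |θ|/2 with hR
  have hr0 := h.r_nonneg
  have hv0 := h.v_nonneg
  have hv := h.v_le
  have ha := abs_nonneg θ
  have hsq : θ^2 = |θ|^2 := (sq_abs θ).symm
  have hV0 : 0 ≤ V := by positivity
  have hR0 : 0 ≤ R := by positivity
  have hRle : R ≤ 7/4 := by rw [hR]; linarith
  have hVR : V ≤ R^2 := by
    rw [hV, hR, hsq]; nlinarith
  have hV1 : V ≤ 1 := by
    rw [hV, hsq]; nlinarith
  have hVRV : V * R ≤ V * (7/4) := by gcongr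
  -- norm bound
  have e1 : 1 - V/6 ≤ Real.exp (-V/6) := by
    have := Real.add_one_le_exp (-V/6); linarith
  have hΦ : ‖PhiF f θ‖ ≤ Real.exp (-V/6) := by
    have := norm_le_norm_add_norm_sub' (PhiF f θ) ((1 - V / 2 : ℝ) : ℂ)
    have h2 : ‖((1 - V / 2 : ℝ) : ℂ)‖ = 1 - V/2 := by
      rw [Complex.norm_real, Real.norm_of_nonneg (by linarith)]
    rw [h2] at this
    linarith
  set w : ℂ := ((Real.exp (-V/2) : ℝ) : ℂ) with hw
  have hwn : ‖w‖ ≤ Real.exp (-V/6) := by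
    rw [hw, Complex.norm_real, Real.norm_of_nonneg (Real.exp_pos _).le]
    apply Real.exp_le_exp.2; linarith
  have hd : ‖PhiF f θ - w‖ ≤ V * R / 2 := by
    have t1 : ‖((1 - V / 2 : ℝ) : ℂ) - w‖ ≤ V^2/8 := by
      rw [hw, ← Complex.ofReal_sub, Complex.norm_real, Real.norm_eq_abs, abs_le]
      have a1 := exp_neg_quad (x := V/2) (by positivity)
      have a2 := Real.add_one_le_exp (-V/2)
      have a3 : Real.exp (-V/2) = Real.exp (-(V/2)) := by congr 1; ring
      rw [a3] at a2 ⊢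
      constructor <;> nlinarith
    have t2 := norm_sub_le_norm_sub_add_norm_sub (PhiF f θ) ((1 - V / 2 : ℝ) : ℂ) w
    have t3 : V^2 ≤ V * (R * (7/4)) := by
      rw [sq]; gcongr
      nlinarith
    nlinarith
  have hp := norm_pow_sub_pow_le' hΦ hwn k
  have hwp : w ^ (k+1) = ((Real.exp (-((k+1:ℝ) * V)/2) : ℝ) : ℂ) := by
    rw [hw, ← Complex.ofReal_pow, ← Real.exp_nat_mul]
    congr 2; push_cast; ring
  rw [hwp] at hp
  refine hp.trans ?_
  have hk : (0:ℝ) ≤ k + 1 := by positivity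
  have e6 : Real.exp (V/6) ≤ 2 := by
    have h1 : Real.exp (V/6) ≤ Real.exp (1/6) := Real.exp_le_exp.2 (by linarith)
    have h2 := Real.exp_bound_div_one_sub_of_interval (x := 1/6) (by norm_num) (by norm_num)
    have h3 : (1:ℝ) / (1 - 1/6) ≤ 2 := by norm_num
    linarith
  have hM : Real.exp (-V/6)^k = Real.exp (-((k+1)*V)/8) * Real.exp (-((k+1)*V/24)) * Real.exp (V/6) := by
    rw [← Real.exp_nat_mul, ← Real.exp_add, ← Real.exp_add]; congr 1; ring
  have hx := mul_exp_neg_le_one (x := (k+1)*V/24)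
  have p1 := Real.exp_pos (-((k+1)*V)/8)
  have p2 := Real.exp_pos (-((k+1)*V/24))
  calc (k+1) * ‖PhiF f θ - w‖ * Real.exp (-V/6)^k
      ≤ (k+1) * (V*R/2) * (Real.exp (-((k+1)*V)/8) * Real.exp (-((k+1)*V/24)) * 2) := by
        rw [hM]; gcongr
    _ = 24 * R * Real.exp (-((k+1)*V)/8) * ((k+1)*V/24 * Real.exp (-((k+1)*V/24))) := by ring
    _ ≤ 24 * R * Real.exp (-((k+1)*V)/8) * 1 := by gcongr
    _ ≤ 36 * R * Real.exp (-((k+1)*V)/8) := by nlinarith [mul_nonneg hR0 p1.le]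

lemma Prof.far (h : Prof f r v) (hr : r ≤ 1/4) {θ : ℝ} (hθ : 3 ≤ |θ|) :
    ‖PhiF f θ‖ ≤ 11/12 := by
  have hθ0 : θ ≠ 0 := by rintro rfl; simp at hθ; linarith
  have hd : ‖PhiF f θ - ∫ x, cexp (((- (θ * (x - 1/2)) : ℝ) : ℂ) * I) ∂unifI‖ ≤ r := by
    have hm := h.meas
    rw [PhiF, ← integral_sub]
    · calc _ ≤ ∫ x, r ∂unifI := by
            refine norm_integral_le_of_norm_le (integrable_const _) ?_
            filter_upwards [ae_restrict_mem measurableSet_Icc] with x hx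
            have : cexp (((f x - θ * (x - 1/2) : ℝ) : ℂ) * I) - cexp (((- (θ * (x - 1/2)) : ℝ) : ℂ) * I)
              = cexp (((- (θ * (x - 1/2)) : ℝ) : ℂ) * I) * (cexp (I * (f x : ℝ)) - 1) := by
              rw [mul_sub (cexp _), ← Complex.exp_add, mul_one]; congr 2; push_cast; ring
            rw [this, norm_mul, Complex.norm_exp_ofReal_mul_I, one_mul]
            exact (Real.norm_exp_I_mul_ofReal_sub_one_le).trans (h.bd x hx)
        _ = r := by simp
    · refine Integrable.mono' (integrable_const (1:ℝ))
        (Measurable.aestronglyMeasurable (by fun_prop)) (ae_of_all _ fun x => ?_)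
      rw [Complex.norm_exp_ofReal_mul_I]
    · refine Integrable.mono' (integrable_const (1:ℝ))
        (Measurable.aestronglyMeasurable (by fun_prop)) (ae_of_all _ fun x => ?_)
      rw [Complex.norm_exp_ofReal_mul_I]
  have h0 : ‖∫ x, cexp (((- (θ * (x - 1/2)) : ℝ) : ℂ) * I) ∂unifI‖ ≤ 2/3 := by
    have e : ∀ x : ℝ, cexp (((- (θ * (x - 1/2)) : ℝ) : ℂ) * I) =
        cexp (((θ/2 : ℝ):ℂ) * I) * cexp ((-(θ:ℂ) * I) * x) := by
      intro x; rw [← Complex.exp_add]; congr 1; push_cast; ring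
    simp_rw [e]
    rw [integral_const_mul, norm_mul, Complex.norm_exp_ofReal_mul_I, one_mul,
      integral_Icc_eq_integral_Ioc, ← intervalIntegral.integral_of_le zero_le_one,
      integral_exp_mul_complex (by simp [hθ0]), norm_div]
    have n1 : ‖-(θ:ℂ) * I‖ = |θ| := by simp
    rw [n1, div_le_iff₀ (by linarith)]
    refine (norm_sub_le _ _).trans ?_
    have n2 : ‖cexp (-(θ:ℂ) * I * (1:ℝ))‖ = 1 := by
      have := Complex.norm_exp_ofReal_mul_I (-θ)
      simpa using this
    rw [n2]; simp; linarith
  have := norm_le_norm_add_norm_sub' (PhiF f θ) (∫ x, cexp (((- (θ * (x - 1/2)) : ℝ) : ℂ) * I) ∂unifI)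
  linarith

end CharEst2

section CharEst3
open FourierTransform Complex Real Filter Topology
open scoped RealInnerProductSpace

/-- kernel of a profile -/
noncomputable def kerF (f : ℝ → ℝ) : ℝ → ℂ := (Icc (0:ℝ) 1).indicator fun x => cexp ((f x : ℂ) * I)

variable {f : ℝ → ℝ} {r v : ℝ}

lemma kerF_unit (hf : Measurable f) : UnitKer (kerF f) := by
  refine ⟨?_, ?_, ?_⟩
  · exact Measurable.indicator (by fun_prop) measurableSet_Icc
  · intro x
    unfold kerF
    by_cases h : x ∈ Icc (0:ℝ) 1
    · rw [indicator_of_mem h, Complex.norm_exp_ofReal_mul_I]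
    · rw [indicator_of_notMem h]; simp
  · intro x h
    unfold kerF
    rw [indicator_of_notMem h]

lemma phi_fourier (f : ℝ → ℝ) (ξ : ℝ) :
    PhiF f (2 * π * ξ) = cexp (((π * ξ : ℝ) : ℂ) * I) * 𝓕 (kerF f) ξ := by
  rw [Real.fourier_real_eq_integral_exp_smul, PhiF, ← integral_const_mul, ← integral_indicator measurableSet_Icc]
  congr 1
  ext x
  by_cases h : x ∈ Icc (0:ℝ) 1
  · rw [indicator_of_mem h, kerF, indicator_of_mem h, smul_eq_mul, ← Complex.exp_add, ← Complex.exp_add]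
    congr 1; push_cast; ring
  · rw [indicator_of_notMem h, kerF, indicator_of_notMem h]; simp

lemma phi_norm_sq (hf : Measurable f) :
    Integrable (fun θ => ‖PhiF f θ‖^2) ∧ ∫ θ, ‖PhiF f θ‖^2 ≤ 2 * π := by
  obtain ⟨h1, h2⟩ := plancherel_le (kerF_unit hf)
  have e : ∀ ξ, ‖𝓕 (kerF f) ξ‖^2 = (fun θ => ‖PhiF f θ‖^2) (2 * π * ξ) := by
    intro ξ
    simp only [phi_fourier, norm_mul, Complex.norm_exp_ofReal_mul_I, one_mul]
  have hpi : 2 * π ≠ 0 := by positivity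
  simp_rw [e] at h1 h2
  constructor
  · exact (integrable_comp_mul_left_iff (fun θ => ‖PhiF f θ‖^2) hpi).1 h1
  · rw [Measure.integral_comp_mul_left (fun θ => ‖PhiF f θ‖^2), abs_of_pos (by positivity), smul_eq_mul,
      inv_mul_le_iff₀ (by positivity)] at h2
    linarith

lemma phi_meas (hf : Measurable f) : Continuous (PhiF f) := by
  have : PhiF f = fun θ => cexp (((π * (θ / (2*π)) : ℝ) : ℂ) * I) * 𝓕 (kerF f) (θ / (2*π)) := by
    ext θ
    rw [← phi_fourier]; congr 1; field_simp
  rw [this]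
  have := (kerF_unit hf).continuous_fourier
  fun_prop

lemma phi_norm_le (θ : ℝ) : ‖PhiF f θ‖ ≤ 1 := by
  calc _ ≤ ∫ x, (1:ℝ) ∂unifI := by
        refine norm_integral_le_of_norm_le (integrable_const _) (ae_of_all _ fun x => ?_)
        rw [Complex.norm_exp_ofReal_mul_I]
    _ = 1 := by simp

lemma phi_pow_int (hf : Measurable f) {n : ℕ} (hn : 2 ≤ n) : Integrable (fun θ => PhiF f θ ^ n) := by
  refine (phi_norm_sq hf).1.mono' ((phi_meas hf).pow n).aestronglyMeasurable (ae_of_all _ fun θ => ?_)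
  rw [norm_pow]
  exact pow_le_pow_of_le_one (norm_nonneg _) (phi_norm_le θ) hn

lemma slice_phi {m : ℕ} (hm : 1 ≤ m) (hf : Measurable f) (S : Set ℝ) (hS : S.Countable)
    (hc : ∀ x ∉ S, ContinuousAt (kerF f) x) :
    ∫ a : Fin m → ℝ, (∏ i, kerF f (a i)) * kerF f (((m+1 : ℕ):ℝ)/2 - ∑ i, a i)
      = ((2 * π : ℝ) : ℂ)⁻¹ * ∫ θ, PhiF f θ ^ (m+1) := by
  rw [slice_inversion hm (kerF_unit hf) S hS hc]
  have e : ∀ ξ : ℝ, cexp (((2 * π * ξ * (((m+1 : ℕ):ℝ)/2) : ℝ) : ℂ) * I) * (𝓕 (kerF f) ξ)^(m+1)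
      = (fun θ => PhiF f θ ^ (m+1)) (2 * π * ξ) := by
    intro ξ
    simp only [phi_fourier, mul_pow]
    rw [← Complex.exp_nat_mul]
    congr 2; push_cast; ring
  simp_rw [e]
  rw [Measure.integral_comp_mul_left (fun θ => PhiF f θ ^ (m+1)), abs_of_pos (by positivity)]
  rw [Complex.real_smul]; simp

lemma le_exp_half_sq (y : ℝ) : y ≤ Real.exp (y^2/2) := by
  have := Real.add_one_le_exp (y^2/2)
  nlinarith [sq_nonneg (y-1)]

lemma abs_mul_gauss {n : ℝ} (hn : 0 < n) (θ : ℝ) :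
    |θ| * Real.exp (-(n * θ^2)/96) ≤ 10 / √n * Real.exp (-(n/192) * θ^2) := by
  have hs : 0 < √n := Real.sqrt_pos.2 hn
  have h := le_exp_half_sq (√n * |θ| / 10)
  have h2 : (√n * |θ| / 10)^2/2 = n * θ^2 / 200 := by
    rw [div_pow, mul_pow, Real.sq_sqrt hn.le, sq_abs]; ring
  rw [h2] at h
  have h3 : |θ| ≤ 10 / √n * Real.exp (n * θ^2 / 192) := by
    have : Real.exp (n * θ^2/200) ≤ Real.exp (n * θ^2/192) := by
      apply Real.exp_le_exp.2
      have : 0 ≤ n * θ^2 := by positivity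
      linarith
    rw [div_mul_eq_mul_div, le_div_iff₀ hs]
    linarith
  calc _ ≤ (10 / √n * Real.exp (n * θ^2 / 192)) * Real.exp (-(n * θ^2)/96) := by gcongr
    _ = _ := by rw [mul_assoc, ← Real.exp_add]; congr 2; ring

lemma Prof.pointwise (h : Prof f r v) (hr : r ≤ 1/4) {n : ℕ} (hn : 2 ≤ n) (θ : ℝ) :
    ‖PhiF f θ ^ n - ((Real.exp (-(n * v)/2) * Real.exp (-(n/24:ℝ) * θ^2) : ℝ) : ℂ)‖
      ≤ (36 * r * Real.exp (-(n*v)/8) + 184 / √n) * Real.exp (-(n/192:ℝ) * θ^2)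
        + (11/12)^(n-2) * ‖PhiF f θ‖^2 := by
  have hn0 : (0:ℝ) < n := by positivity
  have hs : 0 < √(n:ℝ) := Real.sqrt_pos.2 hn0
  have hr0 := h.r_nonneg
  have hv0 := h.v_nonneg
  have hg := abs_mul_gauss hn0 θ
  have hq : 0 ≤ (n:ℝ) * θ^2 := by positivity
  have e96 : Real.exp (-(n * θ^2)/96) ≤ Real.exp (-(n/192:ℝ) * θ^2) := by
    apply Real.exp_le_exp.2; linarith
  have e24 : Real.exp (-(n/24:ℝ) * θ^2) ≤ Real.exp (-(n * θ^2)/96) := by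
    apply Real.exp_le_exp.2; linarith
  set E := Real.exp (-(n/192:ℝ) * θ^2)
  have hE : 0 < E := Real.exp_pos _
  have hev : Real.exp (-(n*v)/8) ≤ 1 := by
    apply Real.exp_le_one_iff.2
    have : 0 ≤ n * v := by positivity
    linarith
  have hev2 : Real.exp (-(n*v)/2) ≤ 1 := by
    apply Real.exp_le_one_iff.2
    have : 0 ≤ n * v := by positivity
    linarith
  have hpos := Real.exp_pos (-(n*v)/8)
  have hsE : 0 ≤ E / √n := by positivity
  have hd1 : 10 / √(n:ℝ) * E = 10 * (E / √n) := by ring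
  have hd2 : 184 / √(n:ℝ) * E = 184 * (E / √n) := by ring
  rcases le_total |θ| 3 with h3 | h3
  · obtain ⟨k, rfl⟩ : ∃ k, n = k + 1 := ⟨n - 1, by omega⟩
    have hc := h.central hr h3 k
    have e1 : Real.exp (-((k+1:ℝ) * (v + θ^2/12))/2) = Real.exp (-((k+1:ℕ) * v)/2) * Real.exp (-((k+1:ℕ)/24:ℝ) * θ^2) := by
      rw [← Real.exp_add]; congr 1; push_cast; ring
    have e2 : Real.exp (-((k+1:ℝ) * (v + θ^2/12))/8) = Real.exp (-((k+1:ℕ) * v)/8) * Real.exp (-((k+1:ℕ) * θ^2)/96) := by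
      rw [← Real.exp_add]; congr 1; push_cast; ring
    rw [e1, e2] at hc
    refine hc.trans ?_
    have p0 : (0:ℝ) ≤ (11/12)^(k+1-2) * ‖PhiF f θ‖^2 := by positivity
    have p1 : 36 * r * (Real.exp (-((k+1:ℕ) * v)/8) * Real.exp (-((k+1:ℕ) * θ^2)/96))
        ≤ 36 * r * (Real.exp (-((k+1:ℕ) * v)/8) * E) := by gcongr
    have p2 : Real.exp (-((k+1:ℕ) * v)/8) * (|θ| * Real.exp (-((k+1:ℕ) * θ^2)/96)) ≤
        1 * (|θ| * Real.exp (-((k+1:ℕ) * θ^2)/96)) := by gcongr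
    nlinarith
  · have hf := h.far hr h3
    have q1 : ‖PhiF f θ ^ n‖ ≤ (11/12)^(n-2) * ‖PhiF f θ‖^2 := by
      rw [norm_pow, ← Nat.sub_add_cancel hn, pow_add]
      simp only [Nat.add_sub_cancel]
      gcongr
    have q2 : ‖((Real.exp (-(n * v)/2) * Real.exp (-(n/24:ℝ) * θ^2) : ℝ) : ℂ)‖ ≤ 10 / √n * E := by
      rw [Complex.norm_real, Real.norm_of_nonneg (by positivity)]
      calc _ ≤ 1 * Real.exp (-(n * θ^2)/96) := by gcongr
        _ ≤ |θ| * Real.exp (-(n * θ^2)/96) := by gcongr; linarith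
        _ ≤ _ := hg
    have q3 : 0 ≤ 36 * r * Real.exp (-(n*v)/8) * E := by positivity
    refine (norm_sub_le _ _).trans ?_
    nlinarith

lemma pow_bern {n : ℕ} (hn : 2 ≤ n) : ((11/12:ℝ))^(n-2) ≤ 14 / n := by
  have hb := one_add_mul_le_pow (a := (1/11:ℝ)) (by norm_num) n
  have h1 : ((11/12:ℝ))^(n-2) * (11/12)^2 * (1 + 1/11)^n = 1 := by
    rw [← pow_add, Nat.sub_add_cancel hn, ← mul_pow]; norm_num
  have hp : (0:ℝ) < (11/12:ℝ)^(n-2) := by positivity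
  have hn0 : (0:ℝ) < n := by positivity
  rw [le_div_iff₀ hn0]
  have h2 : ((11/12:ℝ))^(n-2) * (11/12)^2 * (1 + n * (1/11)) ≤ 1 := by
    calc _ ≤ ((11/12:ℝ))^(n-2) * (11/12)^2 * (1 + 1/11)^n := by gcongr
      _ = 1 := h1
  nlinarith

lemma Prof.main (h : Prof f r v) (hr : r ≤ 1/4) {n : ℕ} (hn : 2 ≤ n) :
    ‖(∫ θ, PhiF f θ ^ n) - ((Real.exp (-(n * v)/2) * √(24 * π / n) : ℝ) : ℂ)‖
      ≤ 5000 / n * (1 + √n * r * Real.exp (-(n*v)/8)) := by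
  have hn0 : (0:ℝ) < n := by positivity
  have hs : 0 < √(n:ℝ) := Real.sqrt_pos.2 hn0
  have hr0 := h.r_nonneg
  have ig : Integrable (fun θ : ℝ => Real.exp (-(n/24:ℝ) * θ^2)) := integrable_exp_neg_mul_sq (by positivity)
  have ig2 : Integrable (fun θ : ℝ => Real.exp (-(n/192:ℝ) * θ^2)) := integrable_exp_neg_mul_sq (by positivity)
  have e1 : ((Real.exp (-(n * v)/2) * √(24 * π / n) : ℝ) : ℂ)
      = ∫ θ : ℝ, ((Real.exp (-(n * v)/2) * Real.exp (-(n/24:ℝ) * θ^2) : ℝ) : ℂ) := by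
    rw [integral_complex_ofReal, integral_const_mul, integral_gaussian]
    have : π / (n/24) = 24 * π / n := by field_simp
    rw [this]
  obtain ⟨p1, p2⟩ := phi_norm_sq h.meas
  have ig3 : Integrable (fun θ : ℝ => ((Real.exp (-(n * v)/2) * Real.exp (-(n/24:ℝ) * θ^2) : ℝ) : ℂ)) :=
    (ig.const_mul _).ofReal
  rw [e1, ← integral_sub (phi_pow_int h.meas hn) ig3]
  have hle := norm_integral_le_of_norm_le
    ((ig2.const_mul (36 * r * Real.exp (-(n*v)/8) + 184 / √n)).add
      (p1.const_mul ((11/12)^(n-2)))) (ae_of_all _ fun θ => h.pointwise hr hn θ)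
  refine hle.trans ?_
  simp only [Pi.add_apply]
  have e2 : ∫ θ : ℝ, ((36 * r * Real.exp (-(n*v)/8) + 184 / √n) * Real.exp (-(n/192:ℝ) * θ^2) +
      (11/12)^(n-2) * ‖PhiF f θ‖^2) =
      (36 * r * Real.exp (-(n*v)/8) + 184 / √n) * √(π / (n/192)) + (11/12)^(n-2) * ∫ θ, ‖PhiF f θ‖^2 := by
    rw [integral_add (ig2.const_mul _) (p1.const_mul _), integral_const_mul, integral_const_mul, integral_gaussian]
  rw [e2]
  have hpi := Real.pi_lt_d2
  have e3 : √(π / (n/192)) ≤ 25 / √n := by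
    rw [Real.sqrt_le_left (by positivity), div_pow, Real.sq_sqrt hn0.le]
    rw [div_div_eq_mul_div, div_le_div_iff_of_pos_right hn0]
    linarith
  have hb := pow_bern hn
  have hx := Real.exp_pos (-(n*v)/8)
  have hss : √(n:ℝ) * √n = n := Real.mul_self_sqrt hn0.le
  calc _ ≤ (36 * r * Real.exp (-(n*v)/8) + 184 / √n) * (25 / √n) + 14 / n * (2 * 3.15) := by
        gcongr
        linarith
    _ = (900 * r * Real.exp (-(n*v)/8) * √n + 4600 + 88.2) / n := by
        generalize Real.exp (-(n*v)/8) = y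
        generalize √(n:ℝ) = s at *
        rw [← hss]; field_simp; ring
    _ ≤ 5000 * (1 + √n * r * Real.exp (-(n*v)/8)) / n := by
        gcongr
        have : 0 ≤ √n * r * Real.exp (-(n*v)/8) := by positivity
        nlinarith
    _ = _ := by ring

end CharEst3

section CondLaw
open FourierTransform Complex Real Filter Topology

/-- slice of the cube -/
def sliceD (m : ℕ) : Set (Fin m → ℝ) :=
  {a | (∀ i, a i ∈ Icc (0:ℝ) 1) ∧ (((m+1 : ℕ) : ℝ)/2 - ∑ i, a i) ∈ Icc (0:ℝ) 1}

/-- the conditional law on the slice -/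
noncomputable def sliceLaw (m : ℕ) : Measure (Fin m → ℝ) := ProbabilityTheory.cond volume (sliceD m)

/-- additive functional on the slice -/
noncomputable def sliceSum (m : ℕ) (f : ℝ → ℝ) (a : Fin m → ℝ) : ℝ :=
  ∑ i, f (a i) + f (((m+1 : ℕ) : ℝ)/2 - ∑ i, a i)

lemma sliceD_meas (m : ℕ) : MeasurableSet (sliceD m) := by
  unfold sliceD
  refine MeasurableSet.inter ?_ ?_
  · have : {a : Fin m → ℝ | ∀ i, a i ∈ Icc (0:ℝ) 1} = ⋂ i, {a | a i ∈ Icc (0:ℝ) 1} := by ext; simp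
    change MeasurableSet {a : Fin m → ℝ | ∀ i, a i ∈ Icc (0:ℝ) 1}
    rw [this]
    exact MeasurableSet.iInter fun i => measurableSet_Icc.preimage (measurable_pi_apply i)
  · have hm : Measurable fun a : Fin m → ℝ => (((m+1 : ℕ) : ℝ)/2 - ∑ i, a i) := by fun_prop
    exact hm measurableSet_Icc

lemma sliceD_fin (m : ℕ) : volume (sliceD m) ≠ ⊤ := by
  have : sliceD m ⊆ Icc 0 1 := fun a ha => ⟨fun i => (ha.1 i).1, fun i => (ha.1 i).2⟩
  exact (measure_mono this).trans_lt (isCompact_Icc.measure_lt_top) |>.ne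

lemma sliceSum_meas (m : ℕ) {f : ℝ → ℝ} (hf : Measurable f) : Measurable (sliceSum m f) := by
  unfold sliceSum
  fun_prop

lemma kerF_prod (m : ℕ) (f : ℝ → ℝ) (a : Fin m → ℝ) :
    (∏ i, kerF f (a i)) * kerF f (((m+1 : ℕ):ℝ)/2 - ∑ i, a i) =
      (sliceD m).indicator (fun a => cexp ((sliceSum m f a : ℂ) * I)) a := by
  by_cases h : a ∈ sliceD m
  · rw [indicator_of_mem h]
    have h1 : ∀ i, kerF f (a i) = cexp ((f (a i) : ℂ) * I) := fun i => indicator_of_mem (h.1 i) _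
    have h2 : kerF f (((m+1 : ℕ):ℝ)/2 - ∑ i, a i) = cexp ((f (((m+1 : ℕ):ℝ)/2 - ∑ i, a i) : ℂ) * I) :=
      indicator_of_mem h.2 _
    simp_rw [h1]
    rw [h2, ← Complex.exp_sum, ← Complex.exp_add]
    congr 1
    unfold sliceSum
    rw [← Finset.sum_mul]
    push_cast; ring
  · rw [indicator_of_notMem h]
    unfold sliceD at h
    simp only [mem_setOf_eq, not_and_or, not_forall] at h
    rcases h with ⟨i, hi⟩ | h
    · have : kerF f (a i) = 0 := indicator_of_notMem hi _
      rw [Finset.prod_eq_zero (Finset.mem_univ i) this, zero_mul]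
    · have : kerF f (((m+1 : ℕ):ℝ)/2 - ∑ i, a i) = 0 := indicator_of_notMem h _
      rw [this, mul_zero]

lemma kerF_cont {f : ℝ → ℝ} {S : Set ℝ} (hc : ∀ x ∉ S, ContinuousAt f x) :
    ∀ x ∉ S ∪ {0, 1}, ContinuousAt (kerF f) x := by
  intro x hx
  simp only [mem_union, mem_insert_iff, mem_singleton_iff, not_or] at hx
  have hg : ContinuousAt (fun x => cexp ((f x : ℂ) * I)) x := by
    have := hc x hx.1
    fun_prop
  unfold kerF
  by_cases h : x ∈ Icc (0:ℝ) 1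
  · have : Icc (0:ℝ) 1 ∈ 𝓝 x := Icc_mem_nhds (lt_of_le_of_ne h.1 (Ne.symm hx.2.1)) (lt_of_le_of_ne h.2 hx.2.2)
    refine hg.congr ?_
    filter_upwards [this] with y hy
    rw [indicator_of_mem hy]
  · have : (Icc (0:ℝ) 1)ᶜ ∈ 𝓝 x := isClosed_Icc.isOpen_compl.mem_nhds h
    refine (continuousAt_const (y := (0:ℂ))).congr ?_
    filter_upwards [this] with y hy
    rw [indicator_of_notMem hy]

lemma slice_int {m : ℕ} (hm : 1 ≤ m) {f : ℝ → ℝ} (hf : Measurable f) {S : Set ℝ} (hS : S.Countable)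
    (hc : ∀ x ∉ S, ContinuousAt f x) :
    ∫ a in sliceD m, cexp ((sliceSum m f a : ℂ) * I) = ((2 * π : ℝ) : ℂ)⁻¹ * ∫ θ, PhiF f θ ^ (m+1) := by
  rw [← slice_phi hm hf (S ∪ {0,1}) (hS.union (by simp)) (kerF_cont hc)]
  simp_rw [kerF_prod]
  rw [integral_indicator (sliceD_meas m)]

lemma prof_zero : Prof (fun _ => 0) 0 0 := by
  constructor <;> simp

lemma slice_vol {m : ℕ} (hm : 1 ≤ m) :
    ((volume.real (sliceD m) : ℝ) : ℂ) = ((2 * π : ℝ) : ℂ)⁻¹ * ∫ θ, PhiF (fun _ => 0) θ ^ (m+1) := by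
  rw [← slice_int hm (f := fun _ => 0) (by fun_prop) (S := ∅) (by simp) (fun x _ => continuousAt_const)]
  simp [sliceSum]

lemma J0_est {m : ℕ} (hm : 2000000 ≤ m) :
    4 / √((m+1:ℕ):ℝ) ≤ 2 * π * volume.real (sliceD m) ∧
    |2 * π * volume.real (sliceD m) - √(24 * π / (m+1:ℕ))| ≤ 5000 / (m+1:ℕ) := by
  have h := prof_zero.main (by norm_num) (n := m+1) (by omega)
  have hv : (∫ θ, PhiF (fun _ => 0) θ ^ (m+1)) = ((2 * π * volume.real (sliceD m) : ℝ) : ℂ) := by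
    have hpi : ((2 * π : ℝ) : ℂ) ≠ 0 := by
      exact_mod_cast (by positivity : (2 * π) ≠ 0)
    rw [Complex.ofReal_mul, slice_vol (by omega), mul_inv_cancel_left₀ hpi]
  rw [hv, ← Complex.ofReal_sub, Complex.norm_real] at h
  have h' : |2 * π * volume.real (sliceD m) - √(24 * π / (m+1:ℕ))| ≤ 5000 / (m+1:ℕ) := by
    simpa using h
  refine ⟨?_, h'⟩
  set n : ℝ := ((m+1:ℕ):ℝ) with hn
  have hn1 : 2000000 ≤ n := by
    rw [hn]; push_cast; 
    have : (2000000:ℝ) ≤ m := by exact_mod_cast hm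
    linarith
  have hn0 : 0 < n := by linarith
  have hs : 1250 ≤ √n := Real.le_sqrt_of_sq_le (by linarith)
  have hpi := Real.pi_gt_three
  have h1 : 8 / √n ≤ √(24 * π / n) := by
    apply Real.le_sqrt_of_sq_le
    rw [div_pow, Real.sq_sqrt hn0.le]
    gcongr; linarith
  have h2 : 5000 / n ≤ 4 / √n := by
    have : √n * √n = n := Real.mul_self_sqrt hn0.le
    rw [div_le_div_iff₀ hn0 (by linarith)]
    nlinarith
  have h3 : 8 / √n = 4 / √n + 4 / √n := by ring
  have := (abs_le.1 h').1
  linarith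

lemma slice_vol_lower {m : ℕ} (hm : 2000000 ≤ m) : 1 / (2 * √((m+1:ℕ):ℝ)) ≤ volume.real (sliceD m) := by
  have h := (J0_est hm).1
  have hpi := Real.pi_le_four
  have hs : 0 < √((m+1:ℕ):ℝ) := Real.sqrt_pos.2 (by positivity)
  have hv : 0 ≤ volume.real (sliceD m) := measureReal_nonneg
  rw [div_le_iff₀ (by positivity)] at h ⊢
  nlinarith [mul_nonneg hv hs.le]

lemma sliceD_pos {m : ℕ} (hm : 2000000 ≤ m) : volume (sliceD m) ≠ 0 := by
  intro h0
  have := slice_vol_lower hm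
  have hs : 0 < √((m+1:ℕ):ℝ) := Real.sqrt_pos.2 (by positivity)
  rw [measureReal_def, h0] at this
  have h2 : 0 < 1 / (2 * √((m+1:ℕ):ℝ)) := by positivity
  simp only [ENNReal.toReal_zero] at this
  linarith

lemma sliceLaw_prob {m : ℕ} (hm : 2000000 ≤ m) : IsProbabilityMeasure (sliceLaw m) :=
  cond_isProbabilityMeasure_of_finite (sliceD_pos hm) (sliceD_fin m)

lemma slice_char {m : ℕ} (hm : 2000000 ≤ m) {f : ℝ → ℝ} {r v : ℝ} (h : Prof f r v) (hr : r ≤ 1/4)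
    {S : Set ℝ} (hS : S.Countable) (hc : ∀ x ∉ S, ContinuousAt f x) :
    ‖(∫ a, cexp ((sliceSum m f a : ℂ) * I) ∂(sliceLaw m)) - ((Real.exp (-((m+1:ℕ) * v)/2) : ℝ) : ℂ)‖
      ≤ 2500 / √((m+1:ℕ):ℝ) * (1 + √((m+1:ℕ):ℝ) * r * Real.exp (-((m+1:ℕ)*v)/8)) := by
  have hM := h.main hr (n := m+1) (by omega)
  obtain ⟨h1, h2⟩ := J0_est hm
  have hI : ∫ a, cexp ((sliceSum m f a : ℂ) * I) ∂(sliceLaw m) =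
      ((2 * π * volume.real (sliceD m) : ℝ) : ℂ)⁻¹ * ∫ θ, PhiF f θ ^ (m+1) := by
    unfold sliceLaw ProbabilityTheory.cond
    rw [integral_smul_measure, slice_int (by omega) h.meas hS hc, Complex.real_smul]
    rw [ENNReal.toReal_inv, ← measureReal_def]
    push_cast
    rw [mul_inv, mul_inv]; ring
  rw [hI]
  set n : ℝ := ((m+1:ℕ):ℝ) with hn
  have hn0 : 0 < n := by positivity
  have hs : 0 < √n := Real.sqrt_pos.2 hn0
  set J := 2 * π * volume.real (sliceD m) with hJ
  have hJ0 : 0 < J := lt_of_lt_of_le (by positivity) h1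
  set K := ∫ θ, PhiF f θ ^ (m+1)
  set e := Real.exp (-(n*v)/2)
  set s := √(24 * π / n)
  have hr0 := h.r_nonneg
  have he1 : e ≤ 1 := by
    apply Real.exp_le_one_iff.2
    have : 0 ≤ n * v := mul_nonneg hn0.le h.v_nonneg
    linarith
  have he0 : 0 < e := Real.exp_pos _
  have hx : 0 ≤ √n * r * Real.exp (-(n*v)/8) := by positivity
  have id : (J:ℂ)⁻¹ * K - (e:ℂ) = (J:ℂ)⁻¹ * ((K - ((e * s : ℝ):ℂ)) + ((e * (s - J) : ℝ) : ℂ)) := by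
    have : (J:ℂ) ≠ 0 := by exact_mod_cast hJ0.ne'
    push_cast
    field_simp; ring
  rw [id, norm_mul, norm_inv, Complex.norm_real, Real.norm_of_nonneg hJ0.le, inv_mul_le_iff₀ hJ0]
  have q2 : ‖((e * (s - J) : ℝ) : ℂ)‖ ≤ 5000 / n := by
    rw [Complex.norm_real, norm_mul, Real.norm_of_nonneg he0.le, Real.norm_eq_abs, abs_sub_comm]
    calc _ ≤ 1 * (5000 / n) := by gcongr
      _ = _ := one_mul _
  have q3 : 10000 / n * (1 + √n * r * Real.exp (-(n*v)/8)) ≤ J * (2500 / √n * (1 + √n * r * Real.exp (-(n*v)/8))) := by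
    calc _ = 4 / √n * (2500 / √n * (1 + √n * r * Real.exp (-(n*v)/8))) := by
          have : √n * √n = n := Real.mul_self_sqrt hn0.le
          generalize Real.exp (-(n*v)/8) = y
          generalize √n = t at *
          rw [← this]; field_simp; ring
      _ ≤ _ := by gcongr
  refine (norm_add_le _ _).trans ?_
  have q4 : 10000 / n * (1 + √n * r * Real.exp (-(n*v)/8)) = 5000 / n * (1 + √n * r * Real.exp (-(n*v)/8)) + 5000 / n + 5000 / n * (√n * r * Real.exp (-(n*v)/8)) := by ring
  have q5 : 0 ≤ 5000 / n * (√n * r * Real.exp (-(n*v)/8)) := by positivity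
  linarith

end CondLaw

section Smooth
open FourierTransform Complex Real Filter Topology

/-- smoothed indicator -/
noncomputable def hker (c R δ x : ℝ) : ℝ := (gaussianReal x (δ^2).toNNReal).real (Ioc c R)

/-- its Fourier weight -/
noncomputable def Hhat (c R δ u : ℝ) : ℂ :=
  ((2 * π : ℝ) : ℂ)⁻¹ * cexp (-((δ^2/2 : ℝ) : ℂ) * (u:ℂ)^2) * ∫ t in Ioc c R, cexp (((-(u * t) : ℝ) : ℂ) * I)

lemma gauss_pdf_fourier {δ : ℝ} (hδ : 0 < δ) (x t : ℝ) :
    ((2 * π : ℝ) : ℂ)⁻¹ * ∫ u : ℝ, cexp (I * ((x - t : ℝ) : ℂ) * u) * cexp (-((δ^2/2 : ℝ) : ℂ) * (u:ℂ)^2)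
      = (gaussianPDFReal x (δ^2).toNNReal t : ℂ) := by
  rw [fourierIntegral_gaussian (by rw [Complex.ofReal_re]; positivity)]
  have h1 : ((π:ℂ) / ((δ^2/2 : ℝ) : ℂ)) ^ (1/2 : ℂ) = ((√(2 * π) / δ : ℝ) : ℂ) := by
    have : ((π:ℂ) / ((δ^2/2 : ℝ) : ℂ)) = ((2 * π / δ^2 : ℝ) : ℂ) := by
      push_cast; field_simp
    rw [this]
    have h2 : (1/2 : ℂ) = ((1/2 : ℝ) : ℂ) := by push_cast; rfl
    rw [h2, ← Complex.ofReal_cpow (by positivity), ← Real.sqrt_eq_rpow, Real.sqrt_div (by positivity),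
      Real.sqrt_sq hδ.le]
  rw [h1, gaussianPDFReal]
  have h3 : cexp (-((x - t : ℝ) : ℂ)^2 / (4 * ((δ^2/2 : ℝ) : ℂ))) = ((Real.exp (-(t - x)^2 / (2 * δ^2)) : ℝ) : ℂ) := by
    rw [Complex.ofReal_exp]; congr 1; push_cast; field_simp; ring
  rw [h3, ← Complex.ofReal_inv, ← Complex.ofReal_mul, ← Complex.ofReal_mul]
  congr 1
  have h4 : (((δ^2).toNNReal : ℝ≥0) : ℝ) = δ^2 := Real.coe_toNNReal _ (by positivity)
  rw [h4]
  rw [← mul_assoc]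
  congr 1
  rw [Real.sqrt_mul (by positivity) (δ^2), Real.sqrt_sq hδ.le]
  have h5 : √(2*π) * √(2*π) = 2 * π := Real.mul_self_sqrt (by positivity)
  have h6 : 0 < √(2*π) := Real.sqrt_pos.2 (by positivity)
  generalize √(2*π) = s at *
  rw [← h5]; field_simp

lemma hker_fourier {c R δ : ℝ} (hδ : 0 < δ) (x : ℝ) :
    (hker c R δ x : ℂ) = ∫ u : ℝ, Hhat c R δ u * cexp (((u * x : ℝ) : ℂ) * I) := by
  have hv : (δ^2).toNNReal ≠ 0 := by
    rw [Ne, Real.toNNReal_eq_zero]; push Not; positivity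
  have h1 : hker c R δ x = ∫ t in Ioc c R, gaussianPDFReal x (δ^2).toNNReal t := by
    rw [hker, measureReal_def, gaussianReal_apply_eq_integral _ hv, ENNReal.toReal_ofReal]
    exact integral_nonneg fun t => gaussianPDFReal_nonneg _ _ _
  rw [h1, ← integral_complex_ofReal]
  simp_rw [← gauss_pdf_fourier hδ, ← integral_const_mul]
  rw [integral_integral_swap]
  · congr 1; ext u
    rw [Hhat, mul_assoc, mul_assoc, ← integral_mul_const, ← integral_const_mul, ← integral_const_mul]
    congr 1; ext t
    congr 1
    rw [mul_comm, ← Complex.exp_add, ← Complex.exp_add, ← Complex.exp_add]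
    congr 1; push_cast; ring
  · have ig : Integrable (fun u : ℝ => Real.exp (-(δ^2/2) * u^2)) := integrable_exp_neg_mul_sq (by positivity)
    have i1 : Integrable (fun _ : ℝ => (1:ℝ)) (volume.restrict (Ioc c R)) := integrable_const _
    have := i1.mul_prod ig
    refine (this.const_mul ((2*π)⁻¹)).mono' (Continuous.aestronglyMeasurable (by fun_prop)) (ae_of_all _ fun p => ?_)
    simp only [Function.uncurry, one_mul]
    rw [norm_mul, norm_mul]
    gcongr
    · rw [norm_inv, Complex.norm_real, Real.norm_of_nonneg (by positivity)]
    · have : I * ((x - p.1 : ℝ):ℂ) * (p.2:ℂ) = (((x - p.1) * p.2 : ℝ) : ℂ) * I := by push_cast; ring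
      rw [this, Complex.norm_exp_ofReal_mul_I, one_mul, Complex.norm_exp]
      apply le_of_eq; congr 1
      have : (-((δ^2/2 : ℝ) : ℂ) * (p.2:ℂ)^2) = ((-(δ^2/2) * p.2^2 : ℝ) : ℂ) := by push_cast; ring
      rw [this, Complex.ofReal_re]

lemma Hhat_cont {c R δ : ℝ} : Continuous (Hhat c R δ) := by
  unfold Hhat
  refine Continuous.mul (by fun_prop) ?_
  have : ∀ u : ℝ, ∀ t, ‖cexp (((-(u * t) : ℝ) : ℂ) * I)‖ ≤ (1:ℝ) := fun u t => by
    rw [Complex.norm_exp_ofReal_mul_I]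
  refine continuous_of_dominated (bound := fun _ => (1:ℝ)) (fun u => Continuous.aestronglyMeasurable (by fun_prop))
    (fun u => ae_of_all _ (this u)) (integrable_const _) (ae_of_all _ fun t => by fun_prop)

lemma Hhat_norm_eq (c R δ u : ℝ) : ‖Hhat c R δ u‖ = (2*π)⁻¹ * Real.exp (-(δ^2/2) * u^2) *
    ‖∫ t in Ioc c R, cexp (((-(u * t) : ℝ) : ℂ) * I)‖ := by
  unfold Hhat
  rw [norm_mul, norm_mul, norm_inv, Complex.norm_real, Real.norm_of_nonneg (by positivity), Complex.norm_exp]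
  have : (-((δ^2/2 : ℝ) : ℂ) * (u:ℂ)^2) = ((-(δ^2/2) * u^2 : ℝ) : ℂ) := by push_cast; ring
  rw [this, Complex.ofReal_re]

lemma two_pi_inv_le : (2*π)⁻¹ ≤ 1 := inv_le_one_of_one_le₀ (by linarith [Real.pi_gt_three])

lemma Hhat_le_gauss {c R δ : ℝ} (hcR : c ≤ R) (u : ℝ) :
    ‖Hhat c R δ u‖ ≤ (R - c) * Real.exp (-(δ^2/2) * u^2) := by
  rw [Hhat_norm_eq]
  have : ‖∫ t in Ioc c R, cexp (((-(u * t) : ℝ) : ℂ) * I)‖ ≤ R - c := by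
    calc _ ≤ ∫ t in Ioc c R, (1:ℝ) := by
          refine norm_integral_le_of_norm_le (integrable_const _) (ae_of_all _ fun t => ?_)
          rw [Complex.norm_exp_ofReal_mul_I]
      _ = R - c := by simp [hcR]
  calc _ ≤ 1 * Real.exp (-(δ^2/2) * u^2) * (R - c) := by
        gcongr; exact two_pi_inv_le
    _ = _ := by ring

lemma Hhat_mul_le {c R δ : ℝ} (hcR : c ≤ R) (u : ℝ) : |u| * ‖Hhat c R δ u‖ ≤ 2 := by
  rcases eq_or_ne u 0 with rfl | hu
  · simp
  rw [Hhat_norm_eq]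
  have e1 : Real.exp (-(δ^2/2) * u^2) ≤ 1 := by
    apply Real.exp_le_one_iff.2
    have : 0 ≤ δ^2/2 * u^2 := by positivity
    linarith
  have : |u| * ‖∫ t in Ioc c R, cexp (((-(u * t) : ℝ) : ℂ) * I)‖ ≤ 2 := by
    have e : ∀ t : ℝ, cexp (((-(u * t) : ℝ) : ℂ) * I) = cexp ((-(u:ℂ) * I) * t) := by
      intro t; congr 1; push_cast; ring
    simp_rw [e]
    rw [← intervalIntegral.integral_of_le hcR, integral_exp_mul_complex (by simp [hu]), norm_div]
    have n1 : ‖-(u:ℂ) * I‖ = |u| := by simp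
    rw [n1, mul_div_cancel₀ _ (abs_ne_zero.2 hu)]
    refine (norm_sub_le _ _).trans ?_
    have n2 : ∀ s : ℝ, ‖cexp (-(u:ℂ) * I * s)‖ = 1 := by
      intro s
      have := Complex.norm_exp_ofReal_mul_I (-u * s)
      rw [← this]; congr 2; push_cast; ring
    rw [n2, n2]; norm_num
  calc _ = (2*π)⁻¹ * Real.exp (-(δ^2/2) * u^2) * (|u| * ‖∫ t in Ioc c R, cexp (((-(u * t) : ℝ) : ℂ) * I)‖) := by ring
    _ ≤ 1 * 1 * 2 := by gcongr; exact two_pi_inv_le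
    _ = 2 := by norm_num

lemma Hhat_le_kappa {c R δ : ℝ} (hcR : c < R) (u : ℝ) :
    ‖Hhat c R δ u‖ ≤ 4 * (R - c) / (1 + (R - c) * |u|) := by
  have h1 := Hhat_le_gauss (δ := δ) hcR.le u
  have h2 := Hhat_mul_le (δ := δ) hcR.le u
  have hT : 0 < R - c := by linarith
  have e1 : Real.exp (-(δ^2/2) * u^2) ≤ 1 := by
    apply Real.exp_le_one_iff.2
    have : 0 ≤ δ^2/2 * u^2 := by positivity
    linarith
  have ha := abs_nonneg u
  rw [le_div_iff₀ (by positivity)]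
  have h3 : ‖Hhat c R δ u‖ ≤ R - c := h1.trans (by nlinarith)
  nlinarith

lemma Hhat_int {c R δ : ℝ} (hδ : 0 < δ) (hcR : c ≤ R) : Integrable (Hhat c R δ) := by
  have ig : Integrable (fun u : ℝ => Real.exp (-(δ^2/2) * u^2)) := integrable_exp_neg_mul_sq (by positivity)
  exact (ig.const_mul (R - c)).mono' Hhat_cont.aestronglyMeasurable (ae_of_all _ fun u => Hhat_le_gauss hcR u)

/-- characteristic function of a planar measure -/
noncomputable def char2 (m : Measure (ℝ × ℝ)) (u w : ℝ) : ℂ :=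
  ∫ p, cexp (((u * p.1 + w * p.2 : ℝ) : ℂ) * I) ∂m

lemma hker_prod_char {c R δ : ℝ} (hδ : 0 < δ) (hcR : c ≤ R) (m : Measure (ℝ × ℝ)) [IsProbabilityMeasure m] :
    ((∫ p, hker c R δ p.1 * hker c R δ p.2 ∂m : ℝ) : ℂ) =
      ∫ z : ℝ × ℝ, Hhat c R δ z.1 * Hhat c R δ z.2 * char2 m z.1 z.2 := by
  rw [← integral_complex_ofReal]
  have e : ∀ p : ℝ × ℝ, ((hker c R δ p.1 * hker c R δ p.2 : ℝ) : ℂ) =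
      ∫ z : ℝ × ℝ, (Hhat c R δ z.1 * Hhat c R δ z.2) * cexp (((z.1 * p.1 + z.2 * p.2 : ℝ) : ℂ) * I) := by
    intro p
    rw [Complex.ofReal_mul, hker_fourier hδ, hker_fourier hδ, ← integral_prod_mul, ← Measure.volume_eq_prod]
    congr 1; ext z
    have : cexp (((z.1 * p.1 + z.2 * p.2 : ℝ) : ℂ) * I) = cexp (((z.1 * p.1 : ℝ) : ℂ) * I) * cexp (((z.2 * p.2 : ℝ) : ℂ) * I) := by
      rw [← Complex.exp_add]; congr 1; push_cast; ring
    rw [this]; ring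
  simp_rw [e]
  rw [integral_integral_swap]
  · congr 1; ext z
    rw [integral_const_mul, char2]
  · have i1 := (Hhat_int (c := c) (R := R) hδ hcR)
    have i2 := i1.mul_prod i1
    have i3 := (integrable_const (μ := m) (1:ℂ)).mul_prod i2
    refine i3.mono ?_ (ae_of_all _ fun q => ?_)
    · have := Hhat_cont (c := c) (R := R) (δ := δ)
      exact Continuous.aestronglyMeasurable (by fun_prop)
    · simp only [Function.uncurry, one_mul]
      rw [norm_mul, Complex.norm_exp_ofReal_mul_I, mul_one]

end Smooth

section Smooth2
open FourierTransform Complex Real Filter Topology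

/-- truncated Fourier weight bound -/
noncomputable def kap (T B u : ℝ) : ℝ := (Ioc (0:ℝ) B).indicator (fun x => 4 * T / (1 + T * x)) |u|

lemma kap_int {T B : ℝ} (hT : 0 < T) (hB : 0 < B) :
    Integrable (kap T B) ∧ ∫ u, kap T B u = 8 * Real.log (1 + T * B) := by
  have hi : IntegrableOn (fun x => 4 * T / (1 + T * x)) (Ioc 0 B) := by
    have : ContinuousOn (fun x => 4 * T / (1 + T * x)) (Icc 0 B) := by
      refine ContinuousOn.div (by fun_prop) (by fun_prop) fun x hx => ?_
      have := hx.1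
      positivity
    exact (this.integrableOn_Icc).mono_set Ioc_subset_Icc_self
  have hi2 : Integrable ((Ioc (0:ℝ) B).indicator (fun x => 4 * T / (1 + T * x))) :=
    (integrable_indicator_iff measurableSet_Ioc).2 hi
  constructor
  · have hb : Integrable ((Icc (-B) B).indicator (fun _ => 4 * T)) :=
      (integrable_indicator_iff measurableSet_Icc).2 (integrableOn_const (by simp))
    refine hb.mono' ?_ (ae_of_all _ fun u => ?_)
    · have : Measurable ((Ioc (0:ℝ) B).indicator (fun x => 4 * T / (1 + T * x))) :=
        Measurable.indicator (by fun_prop) measurableSet_Ioc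
      exact (this.comp measurable_abs).aestronglyMeasurable
    · unfold kap
      by_cases hu : |u| ∈ Ioc 0 B
      · rw [indicator_of_mem hu, indicator_of_mem (show u ∈ Icc (-B) B from abs_le.1 hu.2)]
        have := hu.1
        rw [Real.norm_of_nonneg (by positivity)]
        exact div_le_self (by positivity) (by nlinarith)
      · rw [indicator_of_notMem hu, norm_zero]
        exact indicator_nonneg (fun _ _ => by positivity) _
  · unfold kap
    rw [integral_comp_abs (f := (Ioc (0:ℝ) B).indicator (fun x => 4 * T / (1 + T * x)))]
    rw [setIntegral_indicator measurableSet_Ioc, inter_eq_right.2 Ioc_subset_Ioi_self,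
      ← intervalIntegral.integral_of_le hB.le]
    have hd : ∀ x ∈ uIcc 0 B, HasDerivAt (fun x => 4 * Real.log (1 + T * x)) (4 * T / (1 + T * x)) x := by
      intro x hx
      rw [uIcc_of_le hB.le] at hx
      have h0 : (1 + T * x) ≠ 0 := by have := hx.1; positivity
      have h1 : HasDerivAt (fun x => 1 + T * x) T x := by
        simpa using ((hasDerivAt_id x).const_mul T).const_add 1
      exact ((h1.log h0).const_mul 4).congr_deriv (by ring)
    rw [intervalIntegral.integral_eq_sub_of_hasDerivAt hd]
    · simp; ring
    · rw [intervalIntegrable_iff_integrableOn_Ioc_of_le hB.le]; exact hi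

lemma kap_nonneg {T B : ℝ} (hT : 0 < T) (u : ℝ) : 0 ≤ kap T B u := by
  unfold kap
  refine indicator_nonneg (fun x hx => ?_) _
  have := hx.1; positivity

lemma shear_int {k : ℝ → ℝ} (hk : Integrable k) (ρ : ℝ) :
    Integrable (fun z : ℝ × ℝ => k z.1 * Real.exp (-(1/8) * (z.2 + ρ * z.1)^2)) ∧
    ∫ z : ℝ × ℝ, k z.1 * Real.exp (-(1/8) * (z.2 + ρ * z.1)^2) = (∫ u, k u) * √(π / (1/8)) := by
  have ig : Integrable (fun w : ℝ => Real.exp (-(1/8) * w^2)) := integrable_exp_neg_mul_sq (by norm_num)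
  have hin : ∀ u, ∫ w : ℝ, Real.exp (-(1/8) * (w + ρ * u)^2) = √(π / (1/8)) := by
    intro u
    rw [integral_add_right_eq_self (fun w : ℝ => Real.exp (-(1/8) * w^2)), integral_gaussian]
  have hI : Integrable (fun z : ℝ × ℝ => k z.1 * Real.exp (-(1/8) * (z.2 + ρ * z.1)^2)) := by
    have ms : AEStronglyMeasurable (fun z : ℝ × ℝ => k z.1 * Real.exp (-(1/8) * (z.2 + ρ * z.1)^2))
        ((volume : Measure ℝ).prod volume) :=
      (hk.aestronglyMeasurable.comp_fst).mul (Continuous.aestronglyMeasurable (by fun_prop))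
    rw [Measure.volume_eq_prod, integrable_prod_iff ms]
    constructor
    · exact ae_of_all _ fun u => by exact (ig.comp_add_right (ρ * u)).const_mul (k u)
    · have : ∀ u, ∫ w, ‖k u * Real.exp (-(1/8) * (w + ρ * u)^2)‖ = ‖k u‖ * √(π / (1/8)) := by
        intro u
        simp_rw [norm_mul]
        rw [integral_const_mul]
        congr 1
        rw [← hin u]
        congr 1; ext w
        rw [Real.norm_of_nonneg (Real.exp_pos _).le]
      simp_rw [this]
      exact hk.norm.mul_const _
  refine ⟨hI, ?_⟩
  rw [Measure.volume_eq_prod] at hI ⊢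
  rw [integral_prod _ hI]
  simp_rw [integral_const_mul, hin]
  rw [integral_mul_const]

lemma char2_norm_le (m : Measure (ℝ × ℝ)) [IsProbabilityMeasure m] (u w : ℝ) : ‖char2 m u w‖ ≤ 1 := by
  calc _ ≤ ∫ p, (1:ℝ) ∂m := by
        refine norm_integral_le_of_norm_le (integrable_const _) (ae_of_all _ fun p => ?_)
        rw [Complex.norm_exp_ofReal_mul_I]
    _ = 1 := by simp

lemma char2_cont (m : Measure (ℝ × ℝ)) [IsProbabilityMeasure m] :
    Continuous (fun z : ℝ × ℝ => char2 m z.1 z.2) := by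
  unfold char2
  refine continuous_of_dominated (bound := fun _ => (1:ℝ)) (fun u => Continuous.aestronglyMeasurable (by fun_prop))
    (fun u => ae_of_all _ fun p => ?_) (integrable_const _) (ae_of_all _ fun t => by fun_prop)
  rw [Complex.norm_exp_ofReal_mul_I]

lemma HH_pointwise {c R δ B η ρ : ℝ} (hcR : c < R) (hρ : |ρ| ≤ 1) (hη : 0 ≤ η)
    {D : ℂ} {u w : ℝ} (hu : u ≠ 0) (hw : w ≠ 0) (hB : 0 < B) (hD2 : ‖D‖ ≤ 2)
    (hD : |u| ≤ B → |w| ≤ B → ‖D‖ ≤ η * (1 + (|u| + |w|) * Real.exp (-(u^2+w^2+2*ρ*u*w)/8))) :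
    ‖Hhat c R δ u * Hhat c R δ w * D‖ ≤
      η * (kap (R-c) B u * kap (R-c) B w)
      + 2 * η * (kap (R-c) B u * Real.exp (-(1/8) * (w + ρ * u)^2))
      + 2 * η * (kap (R-c) B w * Real.exp (-(1/8) * (u + ρ * w)^2))
      + 2 * (R-c)^2 * Real.exp (-(δ^2*B^2/4)) * (Real.exp (-(δ^2/4) * u^2) * Real.exp (-(δ^2/4) * w^2)) := by
  have hT : 0 < R - c := by linarith
  have k1 := kap_nonneg (B := B) hT u
  have k2 := kap_nonneg (B := B) hT w
  rw [norm_mul, norm_mul]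
  have g1 := Hhat_le_gauss (δ := δ) hcR.le u
  have g2 := Hhat_le_gauss (δ := δ) hcR.le w
  have m1 := Hhat_mul_le (δ := δ) hcR.le u
  have m2 := Hhat_mul_le (δ := δ) hcR.le w
  by_cases hin : |u| ≤ B ∧ |w| ≤ B
  · have hk : ∀ x : ℝ, x ≠ 0 → |x| ≤ B → ‖Hhat c R δ x‖ ≤ kap (R-c) B x := by
      intro x hx hxB
      unfold kap
      rw [indicator_of_mem (show |x| ∈ Ioc 0 B from ⟨abs_pos.2 hx, hxB⟩)]
      exact Hhat_le_kappa hcR x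
    have a1 := hk u hu hin.1
    have a2 := hk w hw hin.2
    have hD' := hD hin.1 hin.2
    set x := ‖Hhat c R δ u‖
    set y := ‖Hhat c R δ w‖
    have hx0 : 0 ≤ x := norm_nonneg _
    have hy0 : 0 ≤ y := norm_nonneg _
    have hr2 : ρ^2 ≤ 1 := by rw [← sq_abs]; nlinarith [abs_nonneg ρ]
    set E := Real.exp (-(u^2+w^2+2*ρ*u*w)/8)
    have e1 : E ≤ Real.exp (-(1/8) * (w + ρ * u)^2) := by
      apply Real.exp_le_exp.2; nlinarith [sq_nonneg u]
    have e2 : E ≤ Real.exp (-(1/8) * (u + ρ * w)^2) := by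
      apply Real.exp_le_exp.2; nlinarith [sq_nonneg w]
    have hE : 0 < E := Real.exp_pos _
    have p1 : x * y ≤ kap (R-c) B u * kap (R-c) B w := by gcongr
    have p2 : x * (|w| * y) * E ≤ kap (R-c) B u * 2 * Real.exp (-(1/8) * (w + ρ * u)^2) := by gcongr
    have p3 : y * (|u| * x) * E ≤ kap (R-c) B w * 2 * Real.exp (-(1/8) * (u + ρ * w)^2) := by gcongr
    have p4 : 0 ≤ 2 * (R-c)^2 * Real.exp (-(δ^2*B^2/4)) * (Real.exp (-(δ^2/4) * u^2) * Real.exp (-(δ^2/4) * w^2)) := by positivity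
    calc x * y * ‖D‖ ≤ x * y * (η * (1 + (|u| + |w|) * E)) := by gcongr
      _ = η * (x * y) + η * (x * (|w| * y) * E) + η * (y * (|u| * x) * E) := by ring
      _ ≤ η * (kap (R-c) B u * kap (R-c) B w) + η * (kap (R-c) B u * 2 * Real.exp (-(1/8) * (w + ρ * u)^2))
          + η * (kap (R-c) B w * 2 * Real.exp (-(1/8) * (u + ρ * w)^2)) := by gcongr
      _ ≤ _ := by linarith
  · have hB2 : B^2 ≤ u^2 + w^2 := by
      rw [not_and_or] at hin
      push Not at hin
      rcases hin with h | h
      · have : B^2 ≤ |u|^2 := by gcongr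
        rw [sq_abs] at this; nlinarith [sq_nonneg w]
      · have : B^2 ≤ |w|^2 := by gcongr
        rw [sq_abs] at this; nlinarith [sq_nonneg u]
    have p1 : 0 ≤ η * (kap (R-c) B u * kap (R-c) B w) := by positivity
    have p2 : 0 ≤ 2 * η * (kap (R-c) B u * Real.exp (-(1/8) * (w + ρ * u)^2)) := by positivity
    have p3 : 0 ≤ 2 * η * (kap (R-c) B w * Real.exp (-(1/8) * (u + ρ * w)^2)) := by positivity
    have e : Real.exp (-(δ^2/2) * u^2) * Real.exp (-(δ^2/2) * w^2) ≤
        Real.exp (-(δ^2*B^2/4)) * (Real.exp (-(δ^2/4) * u^2) * Real.exp (-(δ^2/4) * w^2)) := by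
      rw [← Real.exp_add, ← Real.exp_add, ← Real.exp_add]
      apply Real.exp_le_exp.2
      nlinarith [mul_le_mul_of_nonneg_left hB2 (sq_nonneg δ)]
    calc _ ≤ ((R - c) * Real.exp (-(δ^2/2) * u^2)) * ((R - c) * Real.exp (-(δ^2/2) * w^2)) * 2 := by gcongr
      _ = 2 * (R-c)^2 * (Real.exp (-(δ^2/2) * u^2) * Real.exp (-(δ^2/2) * w^2)) := by ring
      _ ≤ 2 * (R-c)^2 * (Real.exp (-(δ^2*B^2/4)) * (Real.exp (-(δ^2/4) * u^2) * Real.exp (-(δ^2/4) * w^2))) := by gcongr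
      _ ≤ _ := by linarith

lemma smooth_diff {c R δ B η ρ : ℝ} (hcR : c < R) (hρ : |ρ| ≤ 1) (hη : 0 ≤ η) (hδ : 0 < δ) (hB : 0 < B)
    (m g : Measure (ℝ × ℝ)) [IsProbabilityMeasure m] [IsProbabilityMeasure g]
    (hD : ∀ u w, |u| ≤ B → |w| ≤ B →
      ‖char2 m u w - char2 g u w‖ ≤ η * (1 + (|u| + |w|) * Real.exp (-(u^2+w^2+2*ρ*u*w)/8))) :
    |∫ p, hker c R δ p.1 * hker c R δ p.2 ∂m - ∫ p, hker c R δ p.1 * hker c R δ p.2 ∂g| ≤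
      η * (8 * Real.log (1 + (R-c) * B))^2 + 4 * η * (8 * Real.log (1 + (R-c) * B)) * √(π / (1/8))
       + 2 * (R-c)^2 * Real.exp (-(δ^2*B^2/4)) * (π / (δ^2/4)) := by
  have hT : 0 < R - c := by linarith
  obtain ⟨ki, kI⟩ := kap_int hT hB
  obtain ⟨s1, s2⟩ := shear_int ki ρ
  have t1 : Integrable (fun z : ℝ × ℝ => kap (R-c) B z.2 * Real.exp (-(1/8) * (z.1 + ρ * z.2)^2)) := s1.swap
  have t2 : ∫ z : ℝ × ℝ, kap (R-c) B z.2 * Real.exp (-(1/8) * (z.1 + ρ * z.2)^2) = 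
      (∫ u, kap (R-c) B u) * √(π / (1/8)) := by
    rw [← s2, Measure.volume_eq_prod, ← integral_prod_swap]
    rfl
  rw [Measure.volume_eq_prod] at s2 t2
  have kk := ki.mul_prod ki
  have ig : Integrable (fun u : ℝ => Real.exp (-(δ^2/4) * u^2)) := integrable_exp_neg_mul_sq (by positivity)
  have gg := ig.mul_prod ig
  have Hi : ∀ m : Measure (ℝ × ℝ), IsProbabilityMeasure m →
      Integrable (fun z : ℝ × ℝ => Hhat c R δ z.1 * Hhat c R δ z.2 * char2 m z.1 z.2) := by
    intro m hm
    have i1 := (Hhat_int (c := c) (R := R) hδ hcR.le)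
    refine (i1.mul_prod i1).mono ?_ (ae_of_all _ fun z => ?_)
    · have := Hhat_cont (c := c) (R := R) (δ := δ)
      have := char2_cont m
      exact Continuous.aestronglyMeasurable (by fun_prop)
    · rw [norm_mul]
      exact mul_le_of_le_one_right (norm_nonneg _) (char2_norm_le m _ _)
  rw [← Real.norm_eq_abs, ← Complex.norm_real, Complex.ofReal_sub, hker_prod_char hδ hcR.le,
    hker_prod_char hδ hcR.le, ← integral_sub (Hi m inferInstance) (Hi g inferInstance)]
  have b1 := kk.const_mul η
  have b2 := s1.const_mul (2 * η)
  have b3 := t1.const_mul (2 * η)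
  have b4 := gg.const_mul (2 * (R-c)^2 * Real.exp (-(δ^2*B^2/4)))
  have hne : ∀ᵐ z : ℝ × ℝ, z.1 ≠ 0 ∧ z.2 ≠ 0 := by
    have h0 : ∀ᵐ x : ℝ, x ≠ 0 := by simp [ae_iff]
    have a1 : ∀ᵐ z : ℝ × ℝ ∂((volume : Measure ℝ).prod volume), z.1 ≠ 0 :=
      Measure.quasiMeasurePreserving_fst.ae h0
    have a2 : ∀ᵐ z : ℝ × ℝ ∂((volume : Measure ℝ).prod volume), z.2 ≠ 0 :=
      Measure.quasiMeasurePreserving_snd.ae h0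
    rw [Measure.volume_eq_prod]
    filter_upwards [a1, a2] with z h1 h2 using ⟨h1, h2⟩
  refine (norm_integral_le_of_norm_le (((b1.add b2).add b3).add b4) ?_).trans (le_of_eq ?_)
  · filter_upwards [hne] with z hz
    rw [← mul_sub]
    refine HH_pointwise hcR hρ hη hz.1 hz.2 hB ?_ (hD _ _)
    refine (norm_sub_le _ _).trans ?_
    linarith [char2_norm_le m z.1 z.2, char2_norm_le g z.1 z.2]
  · rw [integral_add' ((b1.add b2).add b3) b4, integral_add' (b1.add b2) b3, integral_add' b1 b2,
      integral_const_mul, integral_const_mul, integral_const_mul, integral_const_mul,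
      s2, t2, integral_prod_mul,
      integral_prod_mul (fun x : ℝ => Real.exp (-(δ^2/4) * x^2)) (fun x : ℝ => Real.exp (-(δ^2/4) * x^2)), kI, integral_gaussian,
      Real.mul_self_sqrt (by positivity)]
    ring

end Smooth2

section Sandwich
open Complex Real Filter Topology

/-- standard Gaussian -/
noncomputable abbrev gam1 : Measure ℝ := gaussianReal 0 1

/-- bivariate Gaussian with correlation `ρ` -/
noncomputable def gam2 (ρ : ℝ) : Measure (ℝ × ℝ) :=
  (gam1.prod gam1).map fun p => (p.1, ρ * p.1 + √(1 - ρ^2) * p.2)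

lemma gam2_map_meas (ρ : ℝ) : Measurable fun p : ℝ × ℝ => (p.1, ρ * p.1 + √(1 - ρ^2) * p.2) := by fun_prop

instance (ρ : ℝ) : IsProbabilityMeasure (gam2 ρ) :=
  Measure.isProbabilityMeasure_map (gam2_map_meas ρ).aemeasurable

lemma char_gam1 (t : ℝ) : ∫ x, cexp (((t * x : ℝ):ℂ) * I) ∂gam1 = ((Real.exp (-t^2/2) : ℝ) : ℂ) := by
  have h := charFun_gaussianReal (μ := 0) (v := 1) t
  rw [charFun_apply_real] at h
  have e : ∀ x : ℝ, cexp (((t * x : ℝ):ℂ) * I) = cexp (t * x * I) := fun x => by push_cast; rfl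
  simp_rw [e]
  rw [h, Complex.ofReal_exp]
  congr 1; push_cast; simp; ring

lemma char_gam2 {ρ : ℝ} (hρ : |ρ| ≤ 1) (u w : ℝ) :
    char2 (gam2 ρ) u w = ((Real.exp (-(u^2+w^2+2*ρ*u*w)/2) : ℝ) : ℂ) := by
  have hr2 : ρ^2 ≤ 1 := by rw [← sq_abs]; nlinarith [abs_nonneg ρ]
  unfold char2 gam2
  rw [integral_map (gam2_map_meas ρ).aemeasurable (Continuous.aestronglyMeasurable (by fun_prop))]
  have e : ∀ p : ℝ × ℝ, cexp (((u * p.1 + w * (ρ * p.1 + √(1-ρ^2) * p.2) : ℝ) : ℂ) * I) =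
      cexp ((((u + w * ρ) * p.1 : ℝ):ℂ) * I) * cexp ((((w * √(1-ρ^2)) * p.2 : ℝ):ℂ) * I) := by
    intro p; rw [← Complex.exp_add]; congr 1; push_cast; ring
  simp_rw [e]
  rw [integral_prod_mul (fun x : ℝ => cexp ((((u + w * ρ) * x : ℝ):ℂ) * I))
    (fun x : ℝ => cexp ((((w * √(1-ρ^2)) * x : ℝ):ℂ) * I)), char_gam1, char_gam1, ← Complex.ofReal_mul, ← Real.exp_add]
  congr 2
  have : (w * √(1-ρ^2))^2 = w^2 * (1 - ρ^2) := by rw [mul_pow, Real.sq_sqrt (by linarith)]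
  rw [this]; ring

lemma gam2_fst {ρ : ℝ} (hρ : |ρ| ≤ 1) : (gam2 ρ).map Prod.fst = gam1 := by
  haveI : IsProbabilityMeasure ((gam2 ρ).map Prod.fst) := Measure.isProbabilityMeasure_map (by fun_prop)
  apply Measure.ext_of_charFun
  ext t
  rw [charFun_apply_real, charFun_apply_real, integral_map (by fun_prop) (Continuous.aestronglyMeasurable (by fun_prop))]
  have h1 := char_gam2 hρ t 0
  have h2 := char_gam1 t
  unfold char2 at h1
  have e : ∀ x : ℝ, cexp (((t * x : ℝ):ℂ) * I) = cexp (t * x * I) := fun x => by push_cast; rfl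
  simp only [zero_mul, add_zero, mul_zero, e] at h1 h2
  rw [h1, h2]; congr 3; ring

lemma gam2_snd {ρ : ℝ} (hρ : |ρ| ≤ 1) : (gam2 ρ).map Prod.snd = gam1 := by
  haveI : IsProbabilityMeasure ((gam2 ρ).map Prod.snd) := Measure.isProbabilityMeasure_map (by fun_prop)
  apply Measure.ext_of_charFun
  ext t
  rw [charFun_apply_real, charFun_apply_real, integral_map (by fun_prop) (Continuous.aestronglyMeasurable (by fun_prop))]
  have h1 := char_gam2 hρ 0 t
  have h2 := char_gam1 t
  unfold char2 at h1
  have e : ∀ x : ℝ, cexp (((t * x : ℝ):ℂ) * I) = cexp (t * x * I) := fun x => by push_cast; rfl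
  simp only [zero_mul, zero_add, mul_zero, e] at h1 h2
  rw [h1, h2]; congr 3; ring

lemma quad_meas : MeasurableSet {p : ℝ × ℝ | 0 < p.1 ∧ 0 < p.2} :=
  (measurableSet_lt measurable_const measurable_fst).inter (measurableSet_lt measurable_const measurable_snd)

lemma Qgauss_eq (ρ : ℝ) : Qgauss ρ = (gam2 ρ).real {p | 0 < p.1 ∧ 0 < p.2} := by
  rw [measureReal_def, gam2, Measure.map_apply (gam2_map_meas ρ) quad_meas]
  rfl

lemma gam1_strip {a b : ℝ} (hab : a ≤ b) : gam1.real (Ioc a b) ≤ b - a := by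
  rw [measureReal_def, gaussianReal_apply_eq_integral _ one_ne_zero, ENNReal.toReal_ofReal
    (integral_nonneg fun t => gaussianPDFReal_nonneg _ _ _)]
  calc ∫ x in Ioc a b, gaussianPDFReal 0 1 x ≤ ∫ x in Ioc a b, (1:ℝ) := by
        refine integral_mono (integrable_gaussianPDFReal 0 1).integrableOn (integrable_const _) fun x => ?_
        simp only [gaussianPDFReal]
        have h1 : (√(2 * π * ((1:ℝ≥0):ℝ)))⁻¹ ≤ 1 := by
          apply inv_le_one_of_one_le₀
          rw [Real.one_le_sqrt]; push_cast; linarith [Real.pi_gt_three]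
        have h2 : Real.exp (-(x-0)^2 / (2 * ((1:ℝ≥0):ℝ))) ≤ 1 := by
          apply Real.exp_le_one_iff.2
          push_cast
          nlinarith [sq_nonneg (x-0)]
        calc _ ≤ (1:ℝ) * 1 := by gcongr
          _ = 1 := one_mul 1
    _ = b - a := by simp [hab]

/-- two sided Gaussian tail -/
noncomputable def gtail (s : ℝ) : ℝ := gam1.real {z | s < |z|}

lemma gtail_nonneg (s : ℝ) : 0 ≤ gtail s := measureReal_nonneg

lemma gtail_meas (s : ℝ) : MeasurableSet {z : ℝ | s < |z|} := measurableSet_lt measurable_const measurable_abs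

lemma gtail_le (s : ℝ) : gtail s ≤ 4 * Real.exp (-s) := by
  have i1 : Integrable (fun z => Real.exp (1 * z)) gam1 := integrable_exp_mul_gaussianReal 1
  have i2 : Integrable (fun z => Real.exp ((-1) * z)) gam1 := integrable_exp_mul_gaussianReal (-1)
  have h1 := measure_ge_le_exp_mul_mgf (μ := gam1) (X := id) s zero_le_one i1
  have h2 := measure_le_le_exp_mul_mgf (μ := gam1) (X := id) (-s) (t := -1) (by norm_num) i2
  have e1 : mgf id gam1 1 = Real.exp (1/2) := by rw [mgf_id_gaussianReal]; simp
  have e2 : mgf id gam1 (-1) = Real.exp (1/2) := by rw [mgf_id_gaussianReal]; simp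
  rw [e1] at h1; rw [e2] at h2
  have h3 : Real.exp (1/2) ≤ 2 := by
    have := Real.exp_bound_div_one_sub_of_interval (x := 1/2) (by norm_num) (by norm_num)
    norm_num at this ⊢; linarith
  have hsub : {z : ℝ | s < |z|} ⊆ {z | s ≤ id z} ∪ {z | id z ≤ -s} := by
    intro z hz
    simp only [mem_ofPred_eq, id] at hz ⊢
    rcases lt_abs.1 hz with h | h
    · left; exact h.le
    · right; show z ≤ -s; linarith
  have := (measureReal_mono (μ := gam1) hsub).trans (measureReal_union_le _ _)
  have p := Real.exp_pos (-s)
  unfold gtail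
  have e3 : Real.exp (-(1) * s) = Real.exp (-s) := by congr 1; ring
  have e4 : Real.exp (-(-1) * -s) = Real.exp (-s) := by congr 1; ring
  rw [e3] at h1; rw [e4] at h2
  nlinarith

lemma hker_eq {c R δ : ℝ} (x : ℝ) : hker c R δ x = gam1.real {z | c < x + δ * z ∧ x + δ * z ≤ R} := by
  have h1 : gaussianReal x (δ^2).toNNReal = (gam1.map (fun z => δ * z)).map (fun z => x + z) := by
    rw [gaussianReal_map_const_mul, gaussianReal_map_const_add]
    congr 1
    · ring
    · rw [mul_one]; ext; simp [sq_nonneg]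
  rw [hker, h1, Measure.map_map (by fun_prop) (by fun_prop), measureReal_def, Measure.map_apply (by fun_prop) measurableSet_Ioc]
  rfl

lemma hker_meas {c R δ : ℝ} : Measurable (hker c R δ) := by
  have : hker c R δ = fun x => (gam1 (Prod.mk x ⁻¹' {p : ℝ × ℝ | c < p.1 + δ * p.2 ∧ p.1 + δ * p.2 ≤ R})).toReal := by
    ext x; rw [hker_eq]; rfl
  rw [this]
  refine Measurable.ennreal_toReal (measurable_measure_prodMk_left ?_)
  have hf : Measurable (fun p : ℝ × ℝ => p.1 + δ * p.2) := by fun_prop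
  exact (measurableSet_lt measurable_const hf).inter (measurableSet_le hf measurable_const)

lemma hker_nonneg {c R δ : ℝ} (x : ℝ) : 0 ≤ hker c R δ x := measureReal_nonneg
lemma hker_le_one {c R δ : ℝ} (x : ℝ) : hker c R δ x ≤ 1 := measureReal_le_one

lemma hker_le {c R δ s x : ℝ} (hδ : 0 < δ) (hx : x ≤ c - δ * s) : hker c R δ x ≤ gtail s := by
  rw [hker_eq]
  refine measureReal_mono fun z hz => ?_
  have h1 : δ * s < δ * z := by linarith [hz.1]
  exact lt_of_lt_of_le (lt_of_mul_lt_mul_left h1 hδ.le) (le_abs_self z)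

lemma hker_ge {c R δ s x : ℝ} (hδ : 0 < δ) (hx : c + δ * s < x) (hx2 : x ≤ R - δ * s) :
    1 - gtail s ≤ hker c R δ x := by
  have h : ({z : ℝ | s < |z|})ᶜ ⊆ {z | c < x + δ * z ∧ x + δ * z ≤ R} := by
    intro z hz
    have hz' : |z| ≤ s := not_lt.1 hz
    obtain ⟨a, b⟩ := abs_le.1 hz'
    constructor <;> nlinarith
  have h2 := measureReal_mono (μ := gam1) h
  rw [probReal_compl_eq_one_sub (gtail_meas s)] at h2
  rw [hker_eq]; exact h2

lemma hh_int {c R δ : ℝ} (m : Measure (ℝ × ℝ)) [IsProbabilityMeasure m] :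
    Integrable (fun p => hker c R δ p.1 * hker c R δ p.2) m := by
  refine (integrable_const (1:ℝ)).mono' ?_ (ae_of_all _ fun p => ?_)
  · exact ((hker_meas.comp measurable_fst).mul (hker_meas.comp measurable_snd)).aestronglyMeasurable
  · rw [Real.norm_of_nonneg (mul_nonneg (hker_nonneg _) (hker_nonneg _))]
    exact mul_le_one₀ (hker_le_one _) (hker_nonneg _) (hker_le_one _)

/-- lower comparison: integral of product vs measure -/
lemma hh_le {c R δ s t : ℝ} (hδ : 0 < δ) (ht : t ≤ c - δ * s) (m : Measure (ℝ × ℝ)) [IsProbabilityMeasure m] :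
    ∫ p, hker c R δ p.1 * hker c R δ p.2 ∂m ≤ m.real {p | t < p.1 ∧ t < p.2} + gtail s := by
  have hms : MeasurableSet {p : ℝ × ℝ | t < p.1 ∧ t < p.2} :=
    (measurableSet_lt measurable_const measurable_fst).inter (measurableSet_lt measurable_const measurable_snd)
  have i1 : Integrable ({p : ℝ × ℝ | t < p.1 ∧ t < p.2}.indicator (1 : ℝ × ℝ → ℝ)) m :=
    (integrable_const (1:ℝ)).indicator hms
  have : m.real {p | t < p.1 ∧ t < p.2} + gtail s =
      ∫ p, ({p : ℝ × ℝ | t < p.1 ∧ t < p.2}.indicator (1 : ℝ × ℝ → ℝ) p + gtail s) ∂m := by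
    rw [integral_add i1 (integrable_const _), integral_indicator_one hms]; simp
  rw [this]
  refine integral_mono (hh_int m) (i1.add (integrable_const _)) fun p => ?_
  have a1 := hker_nonneg (c := c) (R := R) (δ := δ) p.1
  have a2 := hker_nonneg (c := c) (R := R) (δ := δ) p.2
  have b1 := hker_le_one (c := c) (R := R) (δ := δ) p.1
  have b2 := hker_le_one (c := c) (R := R) (δ := δ) p.2
  have hg := gtail_nonneg s
  by_cases hp : t < p.1 ∧ t < p.2
  · simp only [indicator_of_mem (show p ∈ {p : ℝ × ℝ | t < p.1 ∧ t < p.2} from hp), Pi.one_apply, Pi.add_apply]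
    nlinarith
  · simp only [indicator_of_notMem (show p ∉ {p : ℝ × ℝ | t < p.1 ∧ t < p.2} from hp), zero_add, Pi.add_apply]
    rw [not_and_or] at hp
    push Not at hp
    rcases hp with hp | hp
    · have := hker_le (R := R) (c := c) hδ (hp.trans ht); nlinarith
    · have := hker_le (R := R) (c := c) hδ (hp.trans ht); nlinarith

lemma hh_ge {c R δ s t : ℝ} (hδ : 0 < δ) (ht : c + δ * s ≤ t) (m : Measure (ℝ × ℝ)) [IsProbabilityMeasure m] :
    m.real {p | (t < p.1 ∧ t < p.2) ∧ (p.1 ≤ R - δ * s ∧ p.2 ≤ R - δ * s)} ≤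
      ∫ p, hker c R δ p.1 * hker c R δ p.2 ∂m + 2 * gtail s := by
  set S := {p : ℝ × ℝ | (t < p.1 ∧ t < p.2) ∧ (p.1 ≤ R - δ * s ∧ p.2 ≤ R - δ * s)} with hS
  have hms : MeasurableSet S :=
    ((measurableSet_lt measurable_const measurable_fst).inter (measurableSet_lt measurable_const measurable_snd)).inter
    ((measurableSet_le measurable_fst measurable_const).inter (measurableSet_le measurable_snd measurable_const))
  have i1 : Integrable (S.indicator (1 : ℝ × ℝ → ℝ)) m :=
    (integrable_const (1:ℝ)).indicator hms
  have : ∫ p, hker c R δ p.1 * hker c R δ p.2 ∂m + 2 * gtail s =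
      ∫ p, (hker c R δ p.1 * hker c R δ p.2 + 2 * gtail s) ∂m := by
    rw [integral_add (hh_int m) (integrable_const _)]; simp
  rw [this, ← integral_indicator_one hms]
  refine integral_mono i1 ((hh_int m).add (integrable_const _)) fun p => ?_
  have a1 := hker_nonneg (c := c) (R := R) (δ := δ) p.1
  have a2 := hker_nonneg (c := c) (R := R) (δ := δ) p.2
  have b1 := hker_le_one (c := c) (R := R) (δ := δ) p.1
  have b2 := hker_le_one (c := c) (R := R) (δ := δ) p.2
  have hg := gtail_nonneg s
  by_cases hp : p ∈ S
  · simp only [indicator_of_mem hp, Pi.one_apply, Pi.add_apply]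
    have h1 := hker_ge (R := R) (c := c) hδ (ht.trans_lt hp.1.1) hp.2.1
    have h2 := hker_ge (R := R) (c := c) hδ (ht.trans_lt hp.1.2) hp.2.2
    nlinarith
  · simp only [indicator_of_notMem hp, Pi.add_apply]
    positivity

lemma gam2_fst_real {ρ : ℝ} (hρ : |ρ| ≤ 1) {S : Set ℝ} (hS : MeasurableSet S) :
    (gam2 ρ).real {p | p.1 ∈ S} = gam1.real S := by
  rw [← gam2_fst hρ, measureReal_def, measureReal_def, Measure.map_apply measurable_fst hS]; rfl

lemma gam2_snd_real {ρ : ℝ} (hρ : |ρ| ≤ 1) {S : Set ℝ} (hS : MeasurableSet S) :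
    (gam2 ρ).real {p | p.2 ∈ S} = gam1.real S := by
  rw [← gam2_snd hρ, measureReal_def, measureReal_def, Measure.map_apply measurable_snd hS]; rfl

lemma sandwich {δ s R ε1 ρ : ℝ} (hδ : 0 < δ) (hs : 0 ≤ s) (hρ : |ρ| ≤ 1)
    (m : Measure (ℝ × ℝ)) [IsProbabilityMeasure m]
    (hm : ∀ᵐ p ∂m, p.1 ≤ R - δ * s ∧ p.2 ≤ R - δ * s) (hR : s ≤ R - δ * s)
    (h1 : |∫ p, hker (-(δ*s)) R δ p.1 * hker (-(δ*s)) R δ p.2 ∂m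
      - ∫ p, hker (-(δ*s)) R δ p.1 * hker (-(δ*s)) R δ p.2 ∂(gam2 ρ)| ≤ ε1)
    (h2 : |∫ p, hker (δ*s) R δ p.1 * hker (δ*s) R δ p.2 ∂m
      - ∫ p, hker (δ*s) R δ p.1 * hker (δ*s) R δ p.2 ∂(gam2 ρ)| ≤ ε1) :
    |m.real {p | 0 < p.1 ∧ 0 < p.2} - Qgauss ρ| ≤ ε1 + 5 * gtail s + 4 * (δ * s) := by
  rw [Qgauss_eq]
  set l := δ * s with hl
  have hl0 : 0 ≤ l := by positivity
  have u1 : m.real {p | 0 < p.1 ∧ 0 < p.2} ≤ ∫ p, hker (-l) R δ p.1 * hker (-l) R δ p.2 ∂m + 2 * gtail s := by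
    refine le_trans (le_of_eq ?_) (hh_ge (c := -l) (R := R) (s := s) (t := 0) hδ (by rw [← hl]; linarith) m)
    apply measureReal_congr
    filter_upwards [hm] with p hp
    apply propext
    exact ⟨fun h => ⟨h, hp⟩, fun h => h.1⟩
  have u2 := hh_le (c := -l) (R := R) (s := s) (t := -(2*l)) hδ (by rw [← hl]; linarith) (gam2 ρ)
  have u3 : (gam2 ρ).real {p | -(2*l) < p.1 ∧ -(2*l) < p.2} ≤
      (gam2 ρ).real {p | 0 < p.1 ∧ 0 < p.2} + (2*l) + (2*l) := by
    have hsub : {p : ℝ × ℝ | -(2*l) < p.1 ∧ -(2*l) < p.2} ⊆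
      ({p | 0 < p.1 ∧ 0 < p.2} ∪ {p | p.1 ∈ Ioc (-(2*l)) 0}) ∪ {p | p.2 ∈ Ioc (-(2*l)) 0} := by
      rintro p ⟨ha, hb⟩
      by_cases c1 : 0 < p.1
      · by_cases c2 : 0 < p.2
        · exact Or.inl (Or.inl ⟨c1, c2⟩)
        · exact Or.inr ⟨hb, not_lt.1 c2⟩
      · exact Or.inl (Or.inr ⟨ha, not_lt.1 c1⟩)
    have q1 := (measureReal_mono (μ := gam2 ρ) hsub).trans (measureReal_union_le _ _)
    have q2 := measureReal_union_le (μ := gam2 ρ) {p | 0 < p.1 ∧ 0 < p.2} {p | p.1 ∈ Ioc (-(2*l)) 0}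
    rw [gam2_snd_real hρ measurableSet_Ioc] at q1
    rw [gam2_fst_real hρ measurableSet_Ioc] at q2
    have q3 := gam1_strip (a := -(2*l)) (b := 0) (by linarith)
    linarith
  have l1 := hh_le (c := l) (R := R) (s := s) (t := 0) hδ (by rw [← hl]; linarith) m
  have l2 := hh_ge (c := l) (R := R) (s := s) (t := 2*l) hδ (by rw [← hl]; linarith) (gam2 ρ)
  have l3 : (gam2 ρ).real {p | 0 < p.1 ∧ 0 < p.2} ≤
      (gam2 ρ).real {p | (2*l < p.1 ∧ 2*l < p.2) ∧ (p.1 ≤ R - l ∧ p.2 ≤ R - l)}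
        + 2*l + 2*l + gtail s + gtail s := by
    have hsub : {p : ℝ × ℝ | 0 < p.1 ∧ 0 < p.2} ⊆
      ((({p | (2*l < p.1 ∧ 2*l < p.2) ∧ (p.1 ≤ R - l ∧ p.2 ≤ R - l)} ∪ {p | p.1 ∈ Ioc 0 (2*l)})
        ∪ {p | p.2 ∈ Ioc 0 (2*l)}) ∪ {p | p.1 ∈ {z | s < |z|}}) ∪ {p | p.2 ∈ {z | s < |z|}} := by
      rintro p ⟨ha, hb⟩
      by_cases d1 : p.1 ∈ {z | s < |z|}
      · exact Or.inl (Or.inr d1)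
      by_cases d2 : p.2 ∈ {z | s < |z|}
      · exact Or.inr d2
      have e1 : p.1 ≤ R - l := (le_abs_self _).trans ((not_lt.1 d1).trans hR)
      have e2 : p.2 ≤ R - l := (le_abs_self _).trans ((not_lt.1 d2).trans hR)
      refine Or.inl (Or.inl ?_)
      by_cases c1 : 2*l < p.1
      · by_cases c2 : 2*l < p.2
        · exact Or.inl (Or.inl ⟨⟨c1, c2⟩, e1, e2⟩)
        · exact Or.inr ⟨hb, not_lt.1 c2⟩
      · exact Or.inl (Or.inr ⟨ha, not_lt.1 c1⟩)
    have q1 := (measureReal_mono (μ := gam2 ρ) hsub).trans (measureReal_union_le _ _)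
    have q2 := measureReal_union_le (μ := gam2 ρ) (({p | (2*l < p.1 ∧ 2*l < p.2) ∧ (p.1 ≤ R - l ∧ p.2 ≤ R - l)} ∪ {p | p.1 ∈ Ioc 0 (2*l)})
        ∪ {p | p.2 ∈ Ioc 0 (2*l)}) {p | p.1 ∈ {z | s < |z|}}
    have q3 := measureReal_union_le (μ := gam2 ρ) ({p | (2*l < p.1 ∧ 2*l < p.2) ∧ (p.1 ≤ R - l ∧ p.2 ≤ R - l)} ∪ {p | p.1 ∈ Ioc 0 (2*l)}) {p | p.2 ∈ Ioc 0 (2*l)}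
    have q4 := measureReal_union_le (μ := gam2 ρ) {p | (2*l < p.1 ∧ 2*l < p.2) ∧ (p.1 ≤ R - l ∧ p.2 ≤ R - l)} {p | p.1 ∈ Ioc 0 (2*l)}
    rw [gam2_snd_real hρ (gtail_meas s)] at q1
    rw [gam2_fst_real hρ (gtail_meas s)] at q2
    rw [gam2_snd_real hρ measurableSet_Ioc] at q3
    rw [gam2_fst_real hρ measurableSet_Ioc] at q4
    have q5 := gam1_strip (a := 0) (b := 2*l) (by linarith)
    unfold gtail
    linarith
  have r1 := abs_le.1 h1
  have r2 := abs_le.1 h2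
  have hg := gtail_nonneg s
  rw [abs_le]
  constructor
  · linarith [r2.1]
  · linarith [r1.2]

end Sandwich

section BE
open Real Complex

set_option maxHeartbeats 1000000 in
lemma be_eps {N x l L c : ℝ} (hx : 1000 ≤ x) (hN : N = x^2) (hl : l = Real.log N) (hl1 : 1 ≤ l) (hL : 1 ≤ L)
    (hc : |c| ≤ 1) :
    (2500*L/x)*(8*Real.log (1+(N-c)*(x/(8*L))))^2 + 4*(2500*L/x)*(8*Real.log (1+(N-c)*(x/(8*L))))*√(π/(1/8))
      + 2*(N-c)^2*Real.exp (-((32*L*l/x)^2*(x/(8*L))^2/4))*(π/((32*L*l/x)^2/4)) ≤ 1600001 * L * l^2 / x := by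
  have hx0 : 0 < x := by linarith
  have hL0 : 0 < L := by linarith
  have hN1 : 1000000 ≤ N := by rw [hN]; nlinarith
  have hcc := abs_le.1 hc
  have hxN : x ≤ N / 1000 := by rw [hN]; nlinarith
  have hB : x/(8*L) ≤ x/8 := by
    apply div_le_div_of_nonneg_left hx0.le (by norm_num); linarith
  have hB0 : 0 < x/(8*L) := by positivity
  have hT0 : 0 ≤ N - c := by linarith
  have h1 : 1+(N-c)*(x/(8*L)) ≤ N^2 := by
    have : (N-c)*(x/(8*L)) ≤ (N+1)*(x/8) := mul_le_mul (by linarith) hB hB0.le (by linarith)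
    nlinarith
  have h1' : 1 ≤ 1+(N-c)*(x/(8*L)) := by have := mul_nonneg hT0 hB0.le; linarith
  set I := 8*Real.log (1+(N-c)*(x/(8*L))) with hI
  have hI0 : 0 ≤ I := by have := Real.log_nonneg h1'; linarith
  have hI1 : I ≤ 16 * l := by
    have := Real.log_le_log (by linarith) h1
    rw [Real.log_pow, ← hl] at this
    push_cast at this; linarith
  have hsq : √(π/(1/8)) ≤ 6 := by
    rw [Real.sqrt_le_left (by norm_num)]
    have := Real.pi_lt_four
    linarith
  have hη : 0 < 2500*L/x := by positivity
  have t1 : (2500*L/x)*I^2 ≤ (2500*L/x)*(16*l)^2 := by gcongr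
  have t2 : 4*(2500*L/x)*I*√(π/(1/8)) ≤ 4*(2500*L/x)*(16*l^2)*6 := by
    have : I ≤ 16*l^2 := by nlinarith
    gcongr
  have e1 : (32*L*l/x)^2*(x/(8*L))^2/4 = 4*l^2 := by field_simp; norm_num
  have e2 : Real.exp (-((32*L*l/x)^2*(x/(8*L))^2/4)) ≤ 1/N^4 := by
    rw [e1]
    have : Real.exp (-(4*l^2)) ≤ Real.exp (-(4*l)) := Real.exp_le_exp.2 (by nlinarith)
    refine this.trans (le_of_eq ?_)
    rw [Real.exp_neg, show 4*l = ((4:ℕ):ℝ)*l by norm_num, Real.exp_nat_mul, hl, Real.exp_log (by linarith), one_div]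
  have e3 : π/((32*L*l/x)^2/4) ≤ N/64 := by
    rw [div_le_iff₀ (by positivity)]
    have : (32*L*l/x)^2/4 = 256*(L*l)^2/N := by rw [hN]; field_simp; norm_num
    rw [this]
    have h5 : 1 ≤ L * l := by nlinarith
    have h6 : N/64*(256*(L*l)^2/N) = 4*(L*l)^2 := by field_simp; norm_num
    rw [h6]
    have := Real.pi_lt_four
    nlinarith
  have e4 : 2*(N-c)^2 ≤ 8*N^2 := by nlinarith
  have t3 : 2*(N-c)^2*Real.exp (-((32*L*l/x)^2*(x/(8*L))^2/4))*(π/((32*L*l/x)^2/4)) ≤ 8*N^2*(1/N^4)*(N/64) := by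
    gcongr
  have t4 : 8*N^2*(1/N^4)*(N/64) = 1/(8*N) := by field_simp; norm_num
  have t5 : 1/(8*N) ≤ L*l^2/x := by
    rw [div_le_div_iff₀ (by linarith) hx0]
    have hl2 : 1 ≤ l^2 := one_le_pow₀ hl1
    have h7 : 1 ≤ L * l^2 := one_le_mul_of_one_le_of_one_le hL hl2
    have h8 : 1 * (8*N) ≤ L * l^2 * (8*N) := mul_le_mul_of_nonneg_right h7 (by linarith)
    linarith
  have : (2500*L/x)*(16*l)^2 + 4*(2500*L/x)*(16*l^2)*6 + L*l^2/x = 1600001 * L * l^2 / x := by ring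
  linarith

lemma be_lemma {n : ℕ} (hn : 2000000 ≤ n) {L ρ : ℝ} (hL : 1 ≤ L) (hρ : |ρ| ≤ 1)
    (m : Measure (ℝ × ℝ)) [IsProbabilityMeasure m]
    (hm : ∀ᵐ p ∂m, p.1 ≤ L * √(n:ℝ) ∧ p.2 ≤ L * √(n:ℝ))
    (hch : ∀ u w, L * (|u|+|w|) ≤ √(n:ℝ)/4 →
      ‖char2 m u w - ((Real.exp (-(u^2+w^2+2*ρ*u*w)/2) : ℝ) : ℂ)‖ ≤
        2500/√(n:ℝ)*(1+L*(|u|+|w|)*Real.exp (-(u^2+w^2+2*ρ*u*w)/8))) :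
    |m.real {p | 0 < p.1 ∧ 0 < p.2} - Qgauss ρ| ≤ 2000000 * L * Real.log n ^ 2 / √(n:ℝ) := by
  set x := √(n:ℝ) with hxdef
  set l := Real.log (n:ℝ) with hl
  have hnr : (2000000:ℝ) ≤ n := by exact_mod_cast hn
  have hN : (n:ℝ) = x^2 := (Real.sq_sqrt (by linarith)).symm
  have hx : 1000 ≤ x := by rw [hxdef]; apply Real.le_sqrt_of_sq_le; linarith
  have hx0 : 0 < x := by linarith
  have hl1 : 1 ≤ l := by
    rw [hl, Real.le_log_iff_exp_le (by linarith)]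
    have := Real.exp_one_lt_d9; linarith
  have hL0 : 0 < L := by linarith
  have hq0 : 0 ≤ m.real {p : ℝ × ℝ | 0 < p.1 ∧ 0 < p.2} := measureReal_nonneg
  have hq1 : m.real {p : ℝ × ℝ | 0 < p.1 ∧ 0 < p.2} ≤ 1 := measureReal_le_one
  have hq2 : 0 ≤ Qgauss ρ := by rw [Qgauss_eq]; exact measureReal_nonneg
  have hq3 : Qgauss ρ ≤ 1 := by rw [Qgauss_eq]; exact measureReal_le_one
  by_cases hbig : 32*L*l/x*l ≤ 1
  swap
  · push Not at hbig
    have e : 2000000 * L * l ^ 2 / x = 62500 * (32*L*l/x*l) := by ring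
    rw [e, abs_le]; constructor <;> linarith
  have hδ : 0 < 32*L*l/x := by positivity
  have hb0 : 0 ≤ 32*L*l/x*l := by positivity
  have hB : 0 < x/(8*L) := by positivity
  have hη : 0 ≤ 2500*L/x := by positivity
  have hLx : 32*L ≤ x := by
    have : 32*L*l/x*l = 32*L*l^2/x := by ring
    rw [this, div_le_one hx0] at hbig
    have : 1 ≤ l^2 := by nlinarith
    nlinarith
  have hD : ∀ u w, |u| ≤ x/(8*L) → |w| ≤ x/(8*L) →
      ‖char2 m u w - char2 (gam2 ρ) u w‖ ≤ 2500*L/x*(1+(|u|+|w|)*Real.exp (-(u^2+w^2+2*ρ*u*w)/8)) := by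
    intro u w hu hw
    rw [char_gam2 hρ]
    refine (hch u w ?_).trans ?_
    · have : L * (|u|+|w|) ≤ L * (x/(8*L) + x/(8*L)) := by gcongr
      refine this.trans (le_of_eq ?_)
      field_simp; norm_num
    · have h0 : 0 ≤ (|u|+|w|)*Real.exp (-(u^2+w^2+2*ρ*u*w)/8) := by positivity
      have : 2500*L/x*(1+(|u|+|w|)*Real.exp (-(u^2+w^2+2*ρ*u*w)/8)) -
        2500/x*(1+L*(|u|+|w|)*Real.exp (-(u^2+w^2+2*ρ*u*w)/8)) = 2500/x*(L-1) := by ring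
      have h2 : 0 ≤ 2500/x*(L-1) := mul_nonneg (by positivity) (by linarith)
      linarith
  have main : ∀ c : ℝ, |c| ≤ 1 →
      |∫ p, hker c n (32*L*l/x) p.1 * hker c n (32*L*l/x) p.2 ∂m
      - ∫ p, hker c n (32*L*l/x) p.1 * hker c n (32*L*l/x) p.2 ∂(gam2 ρ)| ≤ 1600001 * L * l^2 / x := by
    intro c hc
    have hcR : c < n := by have := (abs_le.1 hc).2; linarith
    exact (smooth_diff hcR hρ hη hδ hB m (gam2 ρ) hD).trans (be_eps hx hN hl hl1 hL hc)
  have hln : l ≤ n - 1 := Real.log_le_sub_one_of_pos (by linarith)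
  have fin := sandwich (R := n) (s := l) hδ (by linarith) hρ m (by
      filter_upwards [hm] with p hp
      have : L * x ≤ n - 32*L*l/x*l := by rw [hN]; nlinarith
      exact ⟨hp.1.trans this, hp.2.trans this⟩) (by linarith)
      (main _ (by rw [abs_neg, abs_of_nonneg hb0]; exact hbig)) (main _ (by rw [abs_of_nonneg hb0]; exact hbig))
  refine fin.trans ?_
  have hg := gtail_le l
  rw [Real.exp_neg, hl, Real.exp_log (by linarith), ← hl] at hg
  have h1 : ((n:ℝ))⁻¹ ≤ L*l^2/x := by
    rw [← one_div, div_le_div_iff₀ (by linarith) hx0]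
    have : 1 ≤ L * l^2 := by nlinarith
    rw [hN]
    nlinarith
  have h2 : 0 ≤ L*l^2/x := by positivity
  have e1 : 1600001 * L * l^2 / x = 1600001 * (L*l^2/x) := by ring
  have e2 : 2000000 * L * l^2 / x = 2000000 * (L*l^2/x) := by ring
  have e3 : 32*L*l/x*l = 32 * (L*l^2/x) := by ring
  rw [e1, e2, e3]
  linarith

end BE

section SliceBE
open Real Complex

lemma Prof.comb {a b : ℝ → ℝ} {L ρ : ℝ} (ha : Prof a L 1) (hb : Prof b L 1)
    (hab : ∫ x, a x * b x ∂unifI = ρ) (s t : ℝ) :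
    Prof (fun x => s * a x + t * b x) (L * (|s| + |t|)) (s^2 + t^2 + 2*ρ*s*t) where
  meas := (ha.meas.const_mul s).add (hb.meas.const_mul t)
  bd := fun x hx => by
    have h1 := ha.bd x hx
    have h2 := hb.bd x hx
    calc |s * a x + t * b x| ≤ |s * a x| + |t * b x| := abs_add_le _ _
      _ = |s| * |a x| + |t| * |b x| := by rw [abs_mul, abs_mul]
      _ ≤ |s| * L + |t| * L := by gcongr
      _ = _ := by ring
  m0 := by
    rw [integral_add (ha.int.const_mul s) (hb.int.const_mul t), integral_const_mul, integral_const_mul, ha.m0, hb.m0]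
    simp
  m1 := by
    have : (fun x => (s * a x + t * b x) * x) = fun x => s * (a x * x) + t * (b x * x) := by ext x; ring
    rw [this, integral_add (ha.int_mul.const_mul s) (hb.int_mul.const_mul t), integral_const_mul, integral_const_mul,
      ha.m1, hb.m1]
    simp
  m2 := by
    have hi : Integrable (fun x => a x * b x) unifI := by
      refine integrable_unifI_of_bdd (C := L*L) (ha.meas.mul hb.meas) fun x hx => ?_
      rw [abs_mul]
      exact mul_le_mul (ha.bd x hx) (hb.bd x hx) (abs_nonneg _) ha.r_nonneg
    have : (fun x => (s * a x + t * b x)^2) = fun x => (s^2 * (a x ^2) + t^2 * (b x ^2)) + (2*s*t) * (a x * b x) := by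
      ext x; ring
    have hi2 : Integrable (fun x => s^2 * (a x ^2) + t^2 * (b x ^2)) unifI :=
      (ha.int_sq.const_mul _).add (hb.int_sq.const_mul _)
    rw [this, integral_add hi2 (hi.const_mul _),
      integral_add (ha.int_sq.const_mul _) (hb.int_sq.const_mul _), integral_const_mul, integral_const_mul,
      integral_const_mul, ha.m2, hb.m2, hab]
    ring

lemma sliceSum_comb (m : ℕ) (a b : ℝ → ℝ) (s t : ℝ) (v : Fin m → ℝ) :
    sliceSum m (fun x => s * a x + t * b x) v = s * sliceSum m a v + t * sliceSum m b v := by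
  unfold sliceSum
  rw [Finset.sum_add_distrib, ← Finset.mul_sum, ← Finset.mul_sum]
  ring

lemma sliceSum_le {m : ℕ} {a : ℝ → ℝ} {L v0 : ℝ} (ha : Prof a L v0) {v : Fin m → ℝ} (hv : v ∈ sliceD m) :
    sliceSum m a v ≤ ((m+1:ℕ):ℝ) * L := by
  unfold sliceSum
  have h1 : ∑ i, a (v i) ≤ ∑ i : Fin m, L :=
    Finset.sum_le_sum fun i _ => (le_abs_self _).trans (ha.bd _ (hv.1 i))
  have h2 := (le_abs_self _).trans (ha.bd _ hv.2)
  simp only [Finset.sum_const, Finset.card_univ, Fintype.card_fin, nsmul_eq_mul] at h1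
  push_cast at h2 ⊢
  linarith

lemma slice_be {m : ℕ} (hm : 2000000 ≤ m) {a b : ℝ → ℝ} {L ρ : ℝ} (hL : 1 ≤ L) (ha : Prof a L 1) (hb : Prof b L 1)
    (hab : ∫ x, a x * b x ∂unifI = ρ) (hρ : |ρ| ≤ 1) {S : Set ℝ} (hS : S.Countable)
    (hca : ∀ x ∉ S, ContinuousAt a x) (hcb : ∀ x ∉ S, ContinuousAt b x) :
    |(sliceLaw m).real {v | 0 < sliceSum m a v ∧ 0 < sliceSum m b v} - Qgauss ρ| ≤
      2000000 * L * Real.log ((m+1:ℕ):ℝ) ^ 2 / √((m+1:ℕ):ℝ) := by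
  have hlp := sliceLaw_prob hm
  set n := m + 1 with hn
  set x := √((n:ℕ):ℝ) with hx
  have hnpos : (0:ℝ) < (n:ℕ) := by rw [hn]; positivity
  have hx0 : 0 < x := Real.sqrt_pos.2 hnpos
  have hxx : x * x = n := Real.mul_self_sqrt hnpos.le
  have hsa := sliceSum_meas m ha.meas
  have hsb := sliceSum_meas m hb.meas
  have hF : Measurable fun v => (sliceSum m a v / x, sliceSum m b v / x) := (hsa.div_const x).prodMk (hsb.div_const x)
  set μ := (sliceLaw m).map (fun v => (sliceSum m a v / x, sliceSum m b v / x)) with hμ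
  have hμp : IsProbabilityMeasure μ := Measure.isProbabilityMeasure_map hF.aemeasurable
  have hq : MeasurableSet {p : ℝ × ℝ | 0 < p.1 ∧ 0 < p.2} :=
    (measurableSet_lt measurable_const measurable_fst).inter (measurableSet_lt measurable_const measurable_snd)
  have hset : μ.real {p | 0 < p.1 ∧ 0 < p.2} = (sliceLaw m).real {v | 0 < sliceSum m a v ∧ 0 < sliceSum m b v} := by
    rw [measureReal_def, measureReal_def, hμ, Measure.map_apply hF hq]
    congr 2
    ext v
    simp [div_pos_iff_of_pos_right hx0]
  rw [← hset]
  refine be_lemma (n := n) (by omega) hL hρ μ ?_ ?_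
  · rw [hμ]
    have hms : MeasurableSet {p : ℝ × ℝ | p.1 ≤ L * x ∧ p.2 ≤ L * x} :=
      (measurableSet_le measurable_fst measurable_const).inter (measurableSet_le measurable_snd measurable_const)
    refine (ae_map_iff hF.aemeasurable hms).2 ?_
    have : ∀ᵐ v ∂(sliceLaw m), v ∈ sliceD m := by
      rw [sliceLaw]
      exact ae_cond_mem (sliceD_meas m)
    filter_upwards [this] with v hv
    have h1 := sliceSum_le ha hv
    have h2 := sliceSum_le hb hv
    constructor
    · rw [div_le_iff₀ hx0]; rw [← hn, ← hxx] at h1; linarith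
    · rw [div_le_iff₀ hx0]; rw [← hn, ← hxx] at h2; linarith
  · intro u w huw
    have hP := ha.comb hb hab (u/x) (w/x)
    have hr : L * (|u/x| + |w/x|) = L * (|u|+|w|) / x := by
      rw [abs_div, abs_div, abs_of_pos hx0]; ring
    have hr4 : L * (|u/x| + |w/x|) ≤ 1/4 := by
      rw [hr, div_le_iff₀ hx0]; linarith
    have key := slice_char hm hP hr4 hS (fun y hy => ((hca y hy).const_mul (u/x)).add ((hcb y hy).const_mul (w/x)))
    have hnv : ((n:ℕ):ℝ) * ((u/x)^2+(w/x)^2+2*ρ*(u/x)*(w/x)) = u^2+w^2+2*ρ*u*w := by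
      rw [← hxx]; field_simp
    have hxr : x * (L * (|u/x| + |w/x|)) = L * (|u|+|w|) := by rw [hr]; field_simp
    rw [← hn, hnv, ← hx, hxr] at key
    have hch : char2 μ u w = ∫ v, cexp (((sliceSum m (fun y => (u/x) * a y + (w/x) * b y) v : ℝ):ℂ)*I) ∂sliceLaw m := by
      unfold char2
      rw [hμ, integral_map hF.aemeasurable (Continuous.aestronglyMeasurable (by fun_prop))]
      congr 1; ext v
      rw [sliceSum_comb]
      have e : u * (sliceSum m a v / x) + w * (sliceSum m b v / x) = u / x * sliceSum m a v + w / x * sliceSum m b v := by ring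
      rw [← e]
    rw [hch]
    exact key

end SliceBE

section Conc
open Real

/-- centred indicator -/
noncomputable def cInd (y x : ℝ) : ℝ := (if x ≤ y then 1 else 0) - y

noncomputable def zsum (m : ℕ) (a : Fin m → ℝ) (y : ℝ) : ℝ := ∑ i, cInd y (a i)

lemma cInd_meas (y : ℝ) : Measurable (cInd y) :=
  (Measurable.ite measurableSet_Iic measurable_const measurable_const).sub_const y

lemma cInd_int {y : ℝ} (hy : y ∈ Icc (0:ℝ) 1) : ∫ x, cInd y x ∂unifI = 0 := by
  have h1 : (fun x => cInd y x) = fun x => (Iic y).indicator (fun _ => (1:ℝ)) x - y := by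
    ext x; simp [cInd, indicator_apply]
  rw [h1, integral_sub ((integrable_const _).indicator measurableSet_Iic) (integrable_const _),
    integral_indicator measurableSet_Iic]
  have h2 : unifI.real (Iic y) = y := by
    rw [unifI, measureReal_def, Measure.restrict_apply measurableSet_Iic]
    have : Iic y ∩ Icc 0 1 = Icc 0 y := by
      ext x; simp only [mem_inter_iff, mem_Iic, mem_Icc]
      exact ⟨fun h => ⟨h.2.1, h.1⟩, fun h => ⟨h.2, h.1, h.2.trans hy.2⟩⟩
    rw [this, Real.volume_Icc, sub_zero, ENNReal.toReal_ofReal hy.1]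
  rw [setIntegral_const, h2]
  simp

lemma cInd_mem {y : ℝ} (hy : y ∈ Icc (0:ℝ) 1) (x : ℝ) : cInd y x ∈ Icc (-y) (1-y) := by
  unfold cInd
  split_ifs
  · exact ⟨by linarith [hy.1, hy.2], le_rfl⟩
  · exact ⟨by linarith [hy.1, hy.2], by linarith [hy.1, hy.2]⟩

lemma hoeff_one (m : ℕ) {X : ℝ → ℝ} (hX : Measurable X) {lo : ℝ} (hmem : ∀ x, X x ∈ Icc lo (lo+1))
    (h0 : ∫ x, X x ∂unifI = 0) {t : ℝ} (ht : 0 ≤ t) :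
    (Measure.pi fun _ : Fin m => unifI).real {a | t ≤ ∑ i, X (a i)} ≤ Real.exp (-(2*t^2/m)) := by
  have hind : iIndepFun (fun (i : Fin m) (a : Fin m → ℝ) => X (a i)) (Measure.pi fun _ : Fin m => unifI) :=
    iIndepFun_pi (X := fun _ => X) (fun _ => hX.aemeasurable)
  have hsg : ∀ i ∈ (Finset.univ : Finset (Fin m)),
      HasSubgaussianMGF (fun a : Fin m → ℝ => X (a i)) ((‖(lo+1) - lo‖₊ / 2) ^ 2) (Measure.pi fun _ : Fin m => unifI) := by
    intro i _
    refine hasSubgaussianMGF_of_mem_Icc_of_integral_eq_zero (hX.comp (measurable_pi_apply i)).aemeasurable (ae_of_all _ fun a => hmem _) ?_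
    rw [integral_comp_eval (μ := fun _ : Fin m => unifI) (f := X) hX.aestronglyMeasurable, h0]
  have := HasSubgaussianMGF.measure_sum_ge_le_of_iIndepFun hind hsg ht
  refine this.trans (le_of_eq ?_)
  congr 1
  simp
  ring

lemma hoeff_two (m : ℕ) {y : ℝ} (hy : y ∈ Icc (0:ℝ) 1) {t : ℝ} (ht : 0 ≤ t) :
    (Measure.pi fun _ : Fin m => unifI).real {a | t ≤ |zsum m a y|} ≤ 2 * Real.exp (-(2*t^2/m)) := by
  have h1 := hoeff_one m (cInd_meas y) (lo := -y) (fun x => by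
    have := cInd_mem hy x; rwa [show -y + 1 = 1 - y by ring]) (cInd_int hy) ht
  have h2 := hoeff_one m (cInd_meas y).neg (lo := -(1-y)) (fun x => by
    have := cInd_mem hy x
    simp only [Pi.neg_apply]
    exact ⟨by linarith [this.2], by linarith [this.1]⟩) (by simp [integral_neg, cInd_int hy]) ht
  have hsub : {a : Fin m → ℝ | t ≤ |zsum m a y|} ⊆ {a | t ≤ ∑ i, cInd y (a i)} ∪ {a | t ≤ ∑ i, (-cInd y) (a i)} := by
    intro a ha
    rcases le_abs.1 (show t ≤ |zsum m a y| from ha) with h | h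
    · exact Or.inl h
    · refine Or.inr ?_
      change t ≤ ∑ i, (-cInd y) (a i)
      simpa [zsum] using h
  have := (measureReal_mono hsub).trans (measureReal_union_le (μ := Measure.pi fun _ : Fin m => unifI) _ _)
  linarith

/-- grid-good set on the slice -/
def gridBad (m : ℕ) (t : ℝ) : Set (Fin m → ℝ) :=
  ⋃ j ∈ Finset.range (m+2), {a | t ≤ |zsum m a ((j:ℝ)/((m+1:ℕ):ℝ))|}

lemma gridBad_cube (m : ℕ) {t : ℝ} (ht : 0 ≤ t) :
    (Measure.pi fun _ : Fin m => unifI).real (gridBad m t) ≤ (m+2:ℕ) * (2 * Real.exp (-(2*t^2/m))) := by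
  unfold gridBad
  refine (measureReal_biUnion_finset_le _ _).trans ?_
  have : ∑ j ∈ Finset.range (m+2), (Measure.pi fun _ : Fin m => unifI).real {a | t ≤ |zsum m a ((j:ℝ)/((m+1:ℕ):ℝ))|}
      ≤ ∑ j ∈ Finset.range (m+2), 2 * Real.exp (-(2*t^2/m)) := by
    refine Finset.sum_le_sum fun j hj => hoeff_two m ⟨by positivity, ?_⟩ ht
    rw [div_le_one (by positivity)]
    have := Finset.mem_range.1 hj
    exact_mod_cast (by omega : j ≤ m+1)
  refine this.trans (le_of_eq ?_)
  simp

lemma vol_le_cube (m : ℕ) (E : Set (Fin m → ℝ)) :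
    volume.real (sliceD m ∩ E) ≤ (Measure.pi fun _ : Fin m => unifI).real E := by
  have h : (Measure.pi fun _ : Fin m => unifI) = (volume : Measure (Fin m → ℝ)).restrict (Set.univ.pi fun _ => Icc (0:ℝ) 1) := by
    rw [volume_pi, Measure.restrict_pi_pi]
  have h2 : volume (sliceD m ∩ E) ≤ (Measure.pi fun _ : Fin m => unifI) E := by
    rw [h]
    refine le_trans (measure_mono ?_) (Measure.le_restrict_apply _ _)
    rintro a ⟨ha, hE⟩
    exact ⟨hE, fun i _ => ha.1 i⟩
  exact ENNReal.toReal_mono (measure_ne_top _ _) h2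

lemma grid_prob {m : ℕ} (hm : 2000000 ≤ m) :
    (sliceLaw m).real (gridBad m (√((m+1:ℕ):ℝ) * Real.log ((m+1:ℕ):ℝ))) ≤ 1/(2*((m+1:ℕ):ℝ)) := by
  set N : ℝ := ((m+1:ℕ):ℝ) with hN
  set t := √N * Real.log N with ht
  have hmr : (2000000:ℝ) ≤ m := by exact_mod_cast hm
  have hN' : N = m + 1 := by rw [hN]; push_cast; ring
  have hN0 : 0 < N := by linarith
  have hx0 : 0 < √N := Real.sqrt_pos.2 hN0
  have hxx : √N ^ 2 = N := Real.sq_sqrt hN0.le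
  have hl : 3 ≤ Real.log N := by
    rw [Real.le_log_iff_exp_le hN0]
    have h1 : Real.exp 3 = Real.exp 1 ^ 3 := by rw [← Real.exp_nat_mul]; norm_num
    have := Real.exp_one_lt_d9
    have h3 : Real.exp 1 ^ 3 ≤ 3 ^ 3 := pow_le_pow_left₀ (Real.exp_pos _).le (by linarith) 3
    rw [h1]; linarith
  have ht0 : 0 ≤ t := by positivity
  have hA := (vol_le_cube m _).trans (gridBad_cube m ht0)
  have hV := slice_vol_lower hm
  rw [← hN] at hV
  have hc : (sliceLaw m).real (gridBad m t) = (volume.real (sliceD m))⁻¹ * volume.real (sliceD m ∩ gridBad m t) := by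
    rw [sliceLaw, measureReal_def, cond_apply (sliceD_meas m), ENNReal.toReal_mul, ENNReal.toReal_inv]
    rfl
  have hexp : Real.exp (-(2*t^2/m)) ≤ 1/N^6 := by
    have h1 : 6 * Real.log N ≤ 2*t^2/m := by
      rw [le_div_iff₀ (by linarith), ht, mul_pow, hxx]
      have : Real.log N * m ≤ Real.log N * N := by nlinarith
      nlinarith [mul_pos hN0 (by linarith : 0 < Real.log N)]
    calc Real.exp (-(2*t^2/m)) ≤ Real.exp (-(6*Real.log N)) := Real.exp_le_exp.2 (by linarith)
      _ = 1/N^6 := by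
        rw [Real.exp_neg, show 6*Real.log N = ((6:ℕ):ℝ)*Real.log N by norm_num, Real.exp_nat_mul, Real.exp_log hN0, one_div]
  have hinv : (volume.real (sliceD m))⁻¹ ≤ 2*√N := by
    have := inv_anti₀ (by positivity) hV
    rwa [one_div, inv_inv] at this
  have hxN : √N ≤ N := by nlinarith
  rw [hc]
  calc (volume.real (sliceD m))⁻¹ * volume.real (sliceD m ∩ gridBad m t)
      ≤ (2*N) * ((2*N) * (2 * (1/N^6))) := by
        refine mul_le_mul (hinv.trans (by linarith)) (hA.trans ?_) measureReal_nonneg (by positivity)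
        have : ((m+2:ℕ):ℝ) ≤ 2*N := by push_cast; linarith
        gcongr
    _ = 8/N^4 := by field_simp; norm_num
    _ ≤ 1/(2*N) := by
      rw [div_le_div_iff₀ (by positivity) (by positivity)]
      have : 16 ≤ N^3 := by
        have : N ≤ N^3 := le_self_pow₀ (by linarith) (by norm_num)
        linarith
      have : 16 * N ≤ N^3 * N := by gcongr
      nlinarith

lemma zsum_interp {m : ℕ} {t : ℝ} {a : Fin m → ℝ} (ha : a ∉ gridBad m t) {x : ℝ} (hx : x ∈ Icc (0:ℝ) 1) :
    |zsum m a x| ≤ t + 1 := by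
  have hN0 : (0:ℝ) < ((m+1:ℕ):ℝ) := by positivity
  set N : ℝ := ((m+1:ℕ):ℝ) with hN
  have hg : ∀ j : ℕ, j ≤ m+1 → |zsum m a ((j:ℝ)/N)| ≤ t := by
    intro j hj
    by_contra hcon
    push Not at hcon
    exact ha (mem_biUnion (x := j) (Finset.mem_coe.2 (Finset.mem_range.2 (by omega))) hcon.le)
  have hmono : ∀ p q : ℝ, p ≤ q → zsum m a p ≤ zsum m a q + m * (q - p) := by
    intro p q hpq
    unfold zsum
    have : ∑ i, cInd p (a i) ≤ ∑ i, (cInd q (a i) + (q-p)) := by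
      refine Finset.sum_le_sum fun i _ => ?_
      unfold cInd
      split_ifs with h1 h2 h2
      · linarith
      · exact absurd (h1.trans hpq) h2
      · linarith
      · linarith
    rw [Finset.sum_add_distrib] at this
    simp only [Finset.sum_const, Finset.card_univ, Fintype.card_fin, nsmul_eq_mul] at this
    exact this
  have hmN : (m:ℝ) * (1/N) ≤ 1 := by
    rw [mul_one_div, div_le_one hN0, hN]; push_cast; linarith
  have hm0 : (0:ℝ) ≤ m := by positivity
  rw [abs_le]
  constructor
  · have h1 : ((⌊N*x⌋₊:ℕ):ℝ) ≤ N*x := Nat.floor_le (mul_nonneg hN0.le hx.1)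
    have h2 : N*x < (⌊N*x⌋₊:ℕ) + 1 := Nat.lt_floor_add_one _
    have h3 : ⌊N*x⌋₊ ≤ m+1 := by
      have : (⌊N*x⌋₊:ℝ) ≤ ((m+1:ℕ):ℝ) := by nlinarith [hx.2]
      exact_mod_cast this
    have h4 := (abs_le.1 (hg _ h3)).1
    have h5 := hmono ((⌊N*x⌋₊:ℕ)/N) x (by rw [div_le_iff₀ hN0]; linarith)
    have h6 : x - (⌊N*x⌋₊:ℕ)/N ≤ 1/N := by
      rw [sub_le_iff_le_add, ← add_div, le_div_iff₀ hN0]; linarith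
    have h7 : (m:ℝ) * (x - (⌊N*x⌋₊:ℕ)/N) ≤ m * (1/N) := by gcongr
    linarith
  · have h1 : N*x ≤ ((⌈N*x⌉₊:ℕ):ℝ) := Nat.le_ceil _
    have h2 : ((⌈N*x⌉₊:ℕ):ℝ) < N*x + 1 := Nat.ceil_lt_add_one (mul_nonneg hN0.le hx.1)
    have h3 : ⌈N*x⌉₊ ≤ m+1 := by
      rw [Nat.ceil_le]; nlinarith [hx.2]
    have h4 := (abs_le.1 (hg _ h3)).2
    have h5 := hmono x ((⌈N*x⌉₊:ℕ)/N) (by rw [le_div_iff₀ hN0]; linarith)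
    have h6 : (⌈N*x⌉₊:ℕ)/N - x ≤ 1/N := by
      rw [sub_le_iff_le_add', ← sub_le_iff_le_add, ← sub_div, div_le_iff₀ hN0]; linarith
    have h7 : (m:ℝ) * ((⌈N*x⌉₊:ℕ)/N - x) ≤ m * (1/N) := by gcongr
    linarith

end Conc

section Final
open Real

lemma extendDie_sum (m : ℕ) (s : ℝ) (a : Fin m → ℝ) (f : ℝ → ℝ) :
    ∑ i, f (extendDie (m+1) s a i) = ∑ i, f (a i) + f (s - ∑ i, a i) := by
  rw [Fin.sum_univ_castSucc]
  simp [extendDie]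

lemma gDie_eq (n : ℕ) (A : Fin n → ℝ) (x : ℝ) : gDie n A x = ∑ i, cInd x (A i) := by
  unfold gDie cInd
  rw [Finset.sum_sub_distrib]
  simp

lemma cInd_meas' (p : ℝ) : Measurable (fun x => cInd x p) :=
  (Measurable.ite measurableSet_Ici measurable_const measurable_const).sub measurable_id

lemma cInd_cont {p x : ℝ} (h : x ≠ p) : ContinuousAt (fun x => cInd x p) x := by
  unfold cInd
  refine ContinuousAt.sub ?_ continuousAt_id
  rcases lt_or_gt_of_ne h with h | h
  · refine (continuousAt_const (y := (0:ℝ))).congr ?_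
    filter_upwards [Iio_mem_nhds h] with y hy
    rw [if_neg (not_le.2 hy)]
  · refine (continuousAt_const (y := (1:ℝ))).congr ?_
    filter_upwards [Ioi_mem_nhds h] with y hy
    rw [if_pos (le_of_lt hy)]

lemma cInd_abs {y : ℝ} (hy : y ∈ Icc (0:ℝ) 1) (x : ℝ) : |cInd y x| ≤ 1 := by
  have := cInd_mem hy x
  rw [abs_le]; exact ⟨by linarith [this.1, hy.2], by linarith [this.2, hy.1]⟩

lemma cInd_int' {p : ℝ} (hp : p ∈ Icc (0:ℝ) 1) : ∫ x, cInd x p ∂unifI = 1/2 - p := by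
  have h1 : (fun x => cInd x p) = fun x => (Ici p).indicator (fun _ => (1:ℝ)) x - x := by
    ext x; simp [cInd, indicator_apply]
  have hid : Integrable (fun x : ℝ => x) unifI :=
    integrable_unifI_of_bdd (C := 1) measurable_id fun x hx => by rw [abs_of_nonneg hx.1]; exact hx.2
  rw [h1, integral_sub ((integrable_const _).indicator measurableSet_Ici) hid,
    integral_indicator measurableSet_Ici, int_unif_id, setIntegral_const]
  have h2 : unifI.real (Ici p) = 1 - p := by
    rw [unifI, measureReal_def, Measure.restrict_apply measurableSet_Ici]
    have : Ici p ∩ Icc 0 1 = Icc p 1 := by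
      ext x; simp only [mem_inter_iff, mem_Ici, mem_Icc]
      exact ⟨fun h => ⟨h.1, h.2.2⟩, fun h => ⟨h.1, hp.1.trans h.1, h.2⟩⟩
    rw [this, Real.volume_Icc, ENNReal.toReal_ofReal (by linarith [hp.2])]
  rw [h2]
  simp; ring

/-- good dice -/
structure GoodDie (n : ℕ) (K : ℝ) (A : Fin n → ℝ) : Prop where
  mem : ∀ i, A i ∈ Icc (0:ℝ) 1
  sum : ∑ i, A i = (n:ℝ)/2
  bd : ∀ x ∈ Icc (0:ℝ) 1, |gDie n A x| ≤ K

lemma gDie_meas (n : ℕ) (A : Fin n → ℝ) : Measurable (gDie n A) := by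
  have : gDie n A = fun x => ∑ i, cInd x (A i) := by ext x; exact gDie_eq n A x
  rw [this]
  exact Finset.measurable_fun_sum _ fun i _ => cInd_meas' _

lemma gDie_cont (n : ℕ) (A : Fin n → ℝ) {x : ℝ} (hx : x ∉ range A) : ContinuousAt (gDie n A) x := by
  have : gDie n A = fun x => ∑ i, cInd x (A i) := by ext x; exact gDie_eq n A x
  rw [this]
  exact tendsto_finsetSum _ fun i _ => cInd_cont fun h => hx ⟨i, h.symm⟩

lemma GoodDie.m0 {n : ℕ} {K : ℝ} {A : Fin n → ℝ} (h : GoodDie n K A) : ∫ x, gDie n A x ∂unifI = 0 := by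
  have : gDie n A = fun x => ∑ i, cInd x (A i) := by ext x; exact gDie_eq n A x
  rw [this, integral_finsetSum]
  · rw [Finset.sum_congr rfl fun i _ => cInd_int' (h.mem i), Finset.sum_sub_distrib, h.sum]
    simp; ring
  · intro i _
    exact integrable_unifI_of_bdd (cInd_meas' _) fun x hx => cInd_abs hx _

lemma good_prob {m : ℕ} (hm : 2000000 ≤ m) :
    ENNReal.ofReal (1 - 1/(2*((m+1:ℕ):ℝ))) ≤ diceMeasure (m+1) 0 1 (((m+1:ℕ):ℝ)/2)
      {A | GoodDie (m+1) (√((m+1:ℕ):ℝ) * Real.log ((m+1:ℕ):ℝ) + 2) A} := by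
  have hlp := sliceLaw_prob hm
  set K := √((m+1:ℕ):ℝ) * Real.log ((m+1:ℕ):ℝ) with hK
  set s := ((m+1:ℕ):ℝ)/2 with hs
  have hmeas : Measurable (extendDie (m+1) s) := by
    refine measurable_pi_lambda _ fun i => ?_
    unfold extendDie
    by_cases h : (i:ℕ) < m + 1 - 1
    · simp only [h, dite_true]; exact measurable_pi_apply _
    · simp only [h, dite_false]
      exact measurable_const.sub (Finset.measurable_fun_sum _ fun i _ => measurable_pi_apply _)
  have h1 : sliceLaw m (extendDie (m+1) s ⁻¹' {A | GoodDie (m+1) (K+2) A}) ≤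
    diceMeasure (m+1) 0 1 s {A | GoodDie (m+1) (K+2) A} :=
    Measure.le_map_apply (μ := sliceLaw m) (f := extendDie (m+1) s) hmeas.aemeasurable _
  refine le_trans ?_ h1
  have hsub : sliceD m \ gridBad m K ⊆ extendDie (m+1) s ⁻¹' {A | GoodDie (m+1) (K+2) A} := by
    rintro a ⟨ha, hb⟩
    refine ⟨?_, ?_, ?_⟩
    · intro i
      unfold extendDie
      by_cases h : (i:ℕ) < m + 1 - 1
      · simp only [h, dite_true]; exact ha.1 _
      · simp only [h, dite_false]; exact ha.2
    · have := extendDie_sum m s a id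
      simp only [id] at this
      rw [this, hs]; ring
    · intro x hx
      rw [gDie_eq, extendDie_sum m s a (cInd x)]
      have e1 := zsum_interp hb hx
      have e2 := cInd_abs hx (s - ∑ i, a i)
      have e3 := abs_add_le (zsum m a x) (cInd x (s - ∑ i, a i))
      unfold zsum at e1 e3
      linarith
  refine le_trans ?_ (measure_mono hsub)
  have hall : sliceLaw m (sliceD m) = 1 := by
    rw [sliceLaw]; exact cond_apply_self (sliceD_pos hm) (sliceD_fin m)
  have h2 : 1 ≤ (sliceLaw m).real (sliceD m \ gridBad m K) + (sliceLaw m).real (gridBad m K) := by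
    refine le_trans ?_ (measureReal_union_le _ _)
    have : (sliceLaw m).real (sliceD m) = 1 := by rw [measureReal_def, hall]; rfl
    rw [← this]
    refine measureReal_mono fun a ha => ?_
    by_cases h : a ∈ gridBad m K
    · exact Or.inr h
    · exact Or.inl ⟨ha, h⟩
  have h3 := grid_prob hm
  rw [ENNReal.ofReal_le_iff_le_toReal (measure_ne_top _ _)]
  rw [measureReal_def] at h2
  linarith

lemma id_int : Integrable (fun x : ℝ => x) unifI :=
  integrable_unifI_of_bdd (C := 1) measurable_id fun x hx => by rw [abs_of_nonneg hx.1]; exact hx.2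

/-- projection off the linear functions -/
noncomputable def projG (g : ℝ → ℝ) (x : ℝ) : ℝ := g x - 12 * (∫ y, g y * y ∂unifI) * (x - 1/2)

lemma mul_id_int {g : ℝ → ℝ} {K : ℝ} (hg : Measurable g) (hK : ∀ x ∈ Icc (0:ℝ) 1, |g x| ≤ K) :
    Integrable (fun y => g y * y) unifI :=
  integrable_unifI_of_bdd (C := K) (hg.mul measurable_id) fun x hx => by
    rw [abs_mul, abs_of_nonneg hx.1]
    have := hK x hx
    nlinarith [hx.1, hx.2, abs_nonneg (g x)]

lemma projG_cross {g h : ℝ → ℝ} {K : ℝ} (hg : Measurable g) (hgK : ∀ x ∈ Icc (0:ℝ) 1, |g x| ≤ K)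
    (hg0 : ∫ x, g x ∂unifI = 0) (hh : Measurable h) (hhK : ∀ x ∈ Icc (0:ℝ) 1, |h x| ≤ K)
    (hh0 : ∫ x, h x ∂unifI = 0) :
    ∫ x, projG g x * projG h x ∂unifI = ∫ x, g x * h x ∂unifI -
      12 * (∫ x, g x * x ∂unifI) * (∫ x, h x * x ∂unifI) := by
  unfold projG
  set c := ∫ x, g x * x ∂unifI with hc
  set d := ∫ x, h x * x ∂unifI with hd
  have hK0 : 0 ≤ K := (abs_nonneg _).trans (hgK 0 (by simp))
  have i1 : Integrable (fun x => g x * h x) unifI :=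
    integrable_unifI_of_bdd (C := K*K) (hg.mul hh) fun x hx => by
      rw [abs_mul]; exact mul_le_mul (hgK x hx) (hhK x hx) (abs_nonneg _) hK0
  have i2 := mul_id_int hg hgK
  have i3 := mul_id_int hh hhK
  have i4 : Integrable g unifI := integrable_unifI_of_bdd hg hgK
  have i5 : Integrable h unifI := integrable_unifI_of_bdd hh hhK
  have i6 : Integrable (fun x : ℝ => (x - 1/2)^2) unifI :=
    integrable_unifI_of_bdd (C := 1) (by fun_prop) fun x hx => by
      rw [abs_of_nonneg (sq_nonneg _)]; nlinarith [hx.1, hx.2]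
  have e : (fun x => (g x - 12*c*(x-1/2)) * (h x - 12*d*(x-1/2))) = fun x =>
      g x * h x - ((12*d) * (g x * x) - (6*d) * g x) - ((12*c) * (h x * x) - (6*c) * h x)
        + (144*c*d) * (x-1/2)^2 := by
    ext x; ring
  have j1 : Integrable (fun x => (12*d) * (g x * x) - (6*d) * g x) unifI := (i2.const_mul _).sub (i4.const_mul _)
  have j2 : Integrable (fun x => (12*c) * (h x * x) - (6*c) * h x) unifI := (i3.const_mul _).sub (i5.const_mul _)
  have j3 : Integrable (fun x => g x * h x - ((12*d) * (g x * x) - (6*d) * g x)) unifI := i1.sub j1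
  have j4 : Integrable (fun x => g x * h x - ((12*d) * (g x * x) - (6*d) * g x) - ((12*c) * (h x * x) - (6*c) * h x)) unifI :=
    j3.sub j2
  rw [e, integral_add j4 (i6.const_mul _), integral_sub j3 j2, integral_sub i1 j1,
    integral_sub (i2.const_mul _) (i4.const_mul _), integral_sub (i3.const_mul _) (i5.const_mul _),
    integral_const_mul, integral_const_mul, integral_const_mul, integral_const_mul, integral_const_mul, int_unif_sq,
    hg0, hh0, ← hc, ← hd]
  ring

lemma projG_prof {g : ℝ → ℝ} {K : ℝ} (hg : Measurable g) (hgK : ∀ x ∈ Icc (0:ℝ) 1, |g x| ≤ K)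
    (hg0 : ∫ x, g x ∂unifI = 0) :
    Prof (projG g) (7*K) (∫ x, g x ^ 2 ∂unifI - 12 * (∫ x, g x * x ∂unifI)^2) where
  meas := hg.sub (by fun_prop)
  bd := fun x hx => by
    unfold projG
    have hK0 : 0 ≤ K := (abs_nonneg _).trans (hgK 0 (by simp))
    have hc : |∫ y, g y * y ∂unifI| ≤ K := by
      have h1 : ∀ᵐ y ∂unifI, ‖g y * y‖ ≤ K := by
        rw [unifI]
        filter_upwards [ae_restrict_mem measurableSet_Icc] with y hy
        rw [Real.norm_eq_abs, abs_mul, abs_of_nonneg hy.1]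
        have := hgK y hy
        nlinarith [hy.1, hy.2, abs_nonneg (g y)]
      have := norm_integral_le_of_norm_le_const h1
      simpa using this
    have h2 : |x - 1/2| ≤ 1/2 := by rw [abs_le]; constructor <;> linarith [hx.1, hx.2]
    calc |g x - 12 * (∫ y, g y * y ∂unifI) * (x - 1/2)| ≤ |g x| + |12 * (∫ y, g y * y ∂unifI) * (x - 1/2)| := abs_sub _ _
      _ = |g x| + 12 * |∫ y, g y * y ∂unifI| * |x - 1/2| := by rw [abs_mul, abs_mul]; norm_num
      _ ≤ K + 12 * K * (1/2) := by
        have := hgK x hx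
        gcongr
      _ = 7*K := by ring
  m0 := by
    unfold projG
    have i4 : Integrable g unifI := integrable_unifI_of_bdd hg hgK
    have i7 : Integrable (fun x : ℝ => x - 1/2) unifI := id_int.sub (integrable_const _)
    rw [integral_sub i4 (i7.const_mul _), integral_const_mul, hg0, integral_sub id_int (integrable_const _), int_unif_id]
    simp
  m1 := by
    unfold projG
    set c := ∫ x, g x * x ∂unifI with hc
    have i2 := mul_id_int hg hgK
    have i6 : Integrable (fun x : ℝ => (x - 1/2)^2) unifI :=
      integrable_unifI_of_bdd (C := 1) (by fun_prop) fun x hx => by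
        rw [abs_of_nonneg (sq_nonneg _)]; nlinarith [hx.1, hx.2]
    have i7 : Integrable (fun x : ℝ => x - 1/2) unifI := id_int.sub (integrable_const _)
    have e : (fun x => (g x - 12*c*(x-1/2)) * x) = fun x => g x * x - ((12*c) * (x-1/2)^2 + (6*c) * (x - 1/2)) := by
      ext x; ring
    have j1 : Integrable (fun x : ℝ => (12*c) * (x-1/2)^2 + (6*c) * (x - 1/2)) unifI := (i6.const_mul _).add (i7.const_mul _)
    rw [e, integral_sub i2 j1, integral_add (i6.const_mul _) (i7.const_mul _), integral_const_mul, integral_const_mul,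
      int_unif_sq, integral_sub id_int (integrable_const _), int_unif_id, ← hc]
    simp; ring
  m2 := by
    have := projG_cross hg hgK hg0 hg hgK hg0
    simp only [← sq] at this
    rw [this]; ring

lemma Prof.scale {f : ℝ → ℝ} {r v L : ℝ} (h : Prof f r v) (hv : 0 < v) (hL : r / √v ≤ L) :
    Prof (fun x => (√v)⁻¹ * f x) L 1 where
  meas := h.meas.const_mul _
  bd := fun x hx => by
    have := h.bd x hx
    rw [abs_mul, abs_of_nonneg (by positivity)]
    refine le_trans ?_ hL
    rw [div_eq_inv_mul]
    gcongr
  m0 := by rw [integral_const_mul, h.m0, mul_zero]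
  m1 := by simp only [mul_assoc]; rw [integral_const_mul, h.m1, mul_zero]
  m2 := by
    simp only [mul_pow]
    rw [integral_const_mul, h.m2, inv_pow, Real.sq_sqrt hv.le, inv_mul_cancel₀ hv.ne']

lemma sliceSum_scale_proj (m : ℕ) (g : ℝ → ℝ) (s : ℝ) (v : Fin m → ℝ) :
    sliceSum m (fun x => s * projG g x) v = s * sliceSum m g v := by
  unfold sliceSum projG
  set c := 12 * ∫ y, g y * y ∂unifI
  rw [← Finset.mul_sum, ← mul_add, Finset.sum_sub_distrib, ← Finset.mul_sum, Finset.sum_sub_distrib]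
  simp only [Finset.sum_const, Finset.card_univ, Fintype.card_fin, nsmul_eq_mul]
  push_cast
  ring

lemma Pcond_eq (m : ℕ) (A B : Fin (m+1) → ℝ) :
    Pcond (m+1) A B = (sliceLaw m).real {v | 0 < sliceSum m (gDie (m+1) A) v ∧ 0 < sliceSum m (gDie (m+1) B) v} := by
  rw [sliceLaw, measureReal_def, cond_apply (sliceD_meas m), ENNReal.toReal_mul, ENNReal.toReal_inv]
  unfold Pcond
  rw [div_eq_inv_mul]
  congr 1
  congr 2
  ext a
  simp only [mem_ofPred_eq, mem_inter_iff]
  have e := fun A : Fin (m+1) → ℝ => extendDie_sum m (((m+1:ℕ):ℝ)/2) a (gDie (m+1) A)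
  rw [e A, e B]
  rfl

lemma final_det {ε : ℝ} (hε : 0 < ε) {m : ℕ} (hm : 2000000 ≤ m) {A B : Fin (m+1) → ℝ}
    (hA : GoodDie (m+1) (√((m+1:ℕ):ℝ) * Real.log ((m+1:ℕ):ℝ) + 2) A)
    (hB : GoodDie (m+1) (√((m+1:ℕ):ℝ) * Real.log ((m+1:ℕ):ℝ) + 2) B)
    (hvA : ε * ((m+1:ℕ):ℝ) ≤ varDie (m+1) A - 12 * cvDie (m+1) A ^ 2)
    (hvB : ε * ((m+1:ℕ):ℝ) ≤ varDie (m+1) B - 12 * cvDie (m+1) B ^ 2) :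
    |Pcond (m+1) A B - Qgauss ((cvDie₂ (m+1) A B - 12 * cvDie (m+1) A * cvDie (m+1) B) /
        √((varDie (m+1) A - 12 * cvDie (m+1) A ^ 2) * (varDie (m+1) B - 12 * cvDie (m+1) B ^ 2)))| ≤
      2000000 * (14/√ε+1) * Real.log ((m+1:ℕ):ℝ) ^ 3 / √((m+1:ℕ):ℝ) := by
  set N : ℝ := ((m+1:ℕ):ℝ) with hN
  have hmr : (2000000:ℝ) ≤ m := by exact_mod_cast hm
  have hN' : N = m + 1 := by rw [hN]; push_cast; ring
  have hN0 : 0 < N := by linarith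
  set x := √N with hx
  have hx0 : 0 < x := Real.sqrt_pos.2 hN0
  have hx2 : 2 ≤ x := by rw [hx]; apply Real.le_sqrt_of_sq_le; linarith
  set l := Real.log N with hl
  have hl1 : 1 ≤ l := by
    rw [hl, Real.le_log_iff_exp_le hN0]
    have := Real.exp_one_lt_d9; linarith
  set K := x * l + 2 with hK
  have hK2 : K ≤ 2 * (x*l) := by nlinarith
  have mA : mean01 (gDie (m+1) A) = 0 := hA.m0
  have mB : mean01 (gDie (m+1) B) = 0 := hB.m0
  have vA : varDie (m+1) A = ∫ y, gDie (m+1) A y ^ 2 ∂unifI := by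
    unfold varDie; rw [mA]; simp only [mean01, unifI]; ring
  have vB : varDie (m+1) B = ∫ y, gDie (m+1) B y ^ 2 ∂unifI := by
    unfold varDie; rw [mB]; simp only [mean01, unifI]; ring
  have cA : cvDie (m+1) A = ∫ y, gDie (m+1) A y * y ∂unifI := by
    unfold cvDie; rw [mA]; simp only [mean01, unifI]; ring
  have cB : cvDie (m+1) B = ∫ y, gDie (m+1) B y * y ∂unifI := by
    unfold cvDie; rw [mB]; simp only [mean01, unifI]; ring
  have cAB : cvDie₂ (m+1) A B = ∫ y, gDie (m+1) A y * gDie (m+1) B y ∂unifI := by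
    unfold cvDie₂; rw [mA]; simp only [mean01, unifI]; ring
  have pA := projG_prof (gDie_meas _ A) hA.bd hA.m0
  have pB := projG_prof (gDie_meas _ B) hB.bd hB.m0
  have pAB := projG_cross (gDie_meas _ A) hA.bd hA.m0 (gDie_meas _ B) hB.bd hB.m0
  rw [← vA, ← cA] at pA
  rw [← vB, ← cB] at pB
  rw [← cAB, ← cA, ← cB] at pAB
  set wA := varDie (m+1) A - 12 * cvDie (m+1) A ^ 2 with hwA
  set wB := varDie (m+1) B - 12 * cvDie (m+1) B ^ 2 with hwB
  have hεN : 0 < ε * N := by positivity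
  have wA0 : 0 < wA := lt_of_lt_of_le hεN hvA
  have wB0 : 0 < wB := lt_of_lt_of_le hεN hvB
  have hLb : ∀ w, ε * N ≤ w → 7 * K / √w ≤ (14/√ε+1) * l := by
    intro w hw
    have h1 : √ε * x ≤ √w := by
      rw [hx, ← Real.sqrt_mul hε.le]; exact Real.sqrt_le_sqrt hw
    have hse : 0 < √ε := Real.sqrt_pos.2 hε
    have h2 : 7 * K / √w ≤ (14 * (x*l)) / (√ε * x) := by
      apply div_le_div₀ (by positivity) (by linarith) (by positivity) h1
    have h3 : (14 * (x*l)) / (√ε * x) = 14/√ε * l := by field_simp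
    rw [h3] at h2
    linarith
  have qA := pA.scale wA0 (hLb _ hvA)
  have qB := pB.scale wB0 (hLb _ hvB)
  set ρ := (cvDie₂ (m+1) A B - 12 * cvDie (m+1) A * cvDie (m+1) B) / √(wA * wB) with hρd
  have hab : ∫ y, ((√wA)⁻¹ * projG (gDie (m+1) A) y) * ((√wB)⁻¹ * projG (gDie (m+1) B) y) ∂unifI = ρ := by
    have e : (fun y => ((√wA)⁻¹ * projG (gDie (m+1) A) y) * ((√wB)⁻¹ * projG (gDie (m+1) B) y)) =
      fun y => ((√wA)⁻¹ * (√wB)⁻¹) * (projG (gDie (m+1) A) y * projG (gDie (m+1) B) y) := by ext y; ring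
    rw [e, integral_const_mul, pAB, hρd, Real.sqrt_mul wA0.le]
    field_simp
  have hρ : |ρ| ≤ 1 := by
    have h1 := (qA.comb qB hab 1 1).v_nonneg
    have h2 := (qA.comb qB hab 1 (-1)).v_nonneg
    rw [abs_le]; constructor <;> linarith
  have hL1 : 1 ≤ (14/√ε+1) * l := by
    have : 0 ≤ 14/√ε := by positivity
    nlinarith
  have projc : ∀ (D : Fin (m+1) → ℝ) (s y : ℝ), y ∉ range D → ContinuousAt (fun y => s * projG (gDie (m+1) D) y) y := by
    intro D s y hy
    refine ContinuousAt.const_mul (ContinuousAt.sub (gDie_cont _ D hy) ?_) s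
    fun_prop
  have key := slice_be hm hL1 qA qB hab hρ (S := range A ∪ range B) ((finite_range A).union (finite_range B)).countable
    (fun y hy => projc A _ y fun h => hy (Or.inl h)) (fun y hy => projc B _ y fun h => hy (Or.inr h))
  rw [Pcond_eq]
  have hset : {v : Fin m → ℝ | 0 < sliceSum m (gDie (m+1) A) v ∧ 0 < sliceSum m (gDie (m+1) B) v} =
    {v | 0 < sliceSum m (fun y => (√wA)⁻¹ * projG (gDie (m+1) A) y) v ∧
      0 < sliceSum m (fun y => (√wB)⁻¹ * projG (gDie (m+1) B) y) v} := by
    have sa : 0 < (√wA)⁻¹ := by positivity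
    have sb : 0 < (√wB)⁻¹ := by positivity
    ext v
    simp only [mem_ofPred_eq, sliceSum_scale_proj]
    rw [mul_pos_iff_of_pos_left sa, mul_pos_iff_of_pos_left sb]
  rw [hset]
  refine key.trans (le_of_eq ?_)
  rw [← hN, ← hl, ← hx]
  ring

end Final

theorem conditional_clt :
    ∀ ε > (0 : ℝ), ∃ C > (0 : ℝ), ∃ c > (0 : ℝ), ∃ N : ℕ, ∀ n : ℕ, N ≤ n → Odd n →
      ((diceMeasure n 0 1 ((n : ℝ) / 2)).prod (diceMeasure n 0 1 ((n : ℝ) / 2)))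
          {p : (Fin n → ℝ) × (Fin n → ℝ) |
            (ε * n ≤ varDie n p.1 - 12 * cvDie n p.1 ^ 2 ∧
             ε * n ≤ varDie n p.2 - 12 * cvDie n p.2 ^ 2) →
            |Pcond n p.1 p.2 -
                Qgauss ((cvDie₂ n p.1 p.2 - 12 * cvDie n p.1 * cvDie n p.2) /
                  Real.sqrt ((varDie n p.1 - 12 * cvDie n p.1 ^ 2) *
                    (varDie n p.2 - 12 * cvDie n p.2 ^ 2)))| ≤
              C * Real.log n ^ c / Real.sqrt n}
        ≥ 1 - (n : ℝ≥0∞)⁻¹ := by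
  intro ε hε
  refine ⟨2000000 * (14/√ε+1), by positivity, 3, by norm_num, 2000001, ?_⟩
  intro n hn _
  obtain ⟨m, rfl⟩ : ∃ m, n = m + 1 := ⟨n - 1, by omega⟩
  have hm : 2000000 ≤ m := by omega
  set N : ℝ := ((m+1:ℕ):ℝ) with hN
  have hmr : (2000000:ℝ) ≤ m := by exact_mod_cast hm
  have hN' : N = m + 1 := by rw [hN]; push_cast; ring
  have hN0 : 0 < N := by linarith
  have hg := good_prob hm
  rw [← hN] at hg
  set G := {A : Fin (m+1) → ℝ | GoodDie (m+1) (√N * Real.log N + 2) A} with hG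
  set μ := diceMeasure (m+1) 0 1 (N/2) with hμ
  have hprob : IsProbabilityMeasure (sliceLaw m) := sliceLaw_prob hm
  have hfin : IsFiniteMeasure μ := by
    rw [hμ]
    exact (inferInstance : IsFiniteMeasure (Measure.map (extendDie (m+1) (N/2)) (sliceLaw m)))
  have h1 : (μ.prod μ) (G ×ˢ G) = μ G * μ G := Measure.prod_prod _ _
  have h2 : 1 - ((m+1:ℕ):ℝ≥0∞)⁻¹ ≤ μ G * μ G := by
    refine le_trans ?_ (mul_le_mul' hg hg)
    have hp : 0 ≤ 1 - 1/(2*N) := by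
      have : 1/(2*N) ≤ 1 := by rw [div_le_one (by positivity)]; linarith
      linarith
    rw [← ENNReal.ofReal_mul hp]
    have e : 1 - ((m+1:ℕ):ℝ≥0∞)⁻¹ = ENNReal.ofReal (1 - 1/N) := by
      rw [ENNReal.ofReal_sub _ (by positivity), ENNReal.ofReal_one, one_div, ENNReal.ofReal_inv_of_pos hN0, hN,
        ENNReal.ofReal_natCast]
    rw [e]
    apply ENNReal.ofReal_le_ofReal
    have : (1 - 1/(2*N)) * (1 - 1/(2*N)) = 1 - 1/N + (1/(2*N))^2 := by field_simp; ring
    rw [this]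
    have := sq_nonneg (1/(2*N))
    linarith
  refine ge_iff_le.2 (h2.trans (h1.symm.le.trans (measure_mono ?_)))
  rintro ⟨A, B⟩ ⟨hA, hB⟩
  rintro ⟨hvA, hvB⟩
  have := final_det hε hm hA hB hvA hvB
  have e : Real.log N ^ (3:ℝ) = Real.log N ^ 3 := by exact_mod_cast Real.rpow_natCast (Real.log N) 3
  change _ ≤ 2000000 * (14/√ε+1) * Real.log N ^ (3:ℝ) / √N
  rw [e]
  exact this
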